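/- For every sufficiently small ε > 0 there exists γ0 > 0 such that for every γ ∈ (0, γ0) there exists n0 ∈ ℕ such that the following holds for all n ≥ n0. Let H be a balanced 4-partite 4-graph with vertex classes V1, V2, V3, V4, each of size n, such that H is not ε-close to H'_{1,3}(n) and d_H({x,y}) ≥ (5/9 − γ)n² for every x ∈ V1 and every y ∈ V2 ∪ V3 ∪ V4. Then there exist ⌊n/ln n⌋ fractional perfect matchings f1, …, f_{⌊n/ln n⌋} of H with pairwise disjoint supports such that for every pair of distinct vertices x, y of H, Σ_{i=1}^{⌊n/ln n⌋} Σ_{e ∈ E(H), {x,y} ⊆ e} f_i(e) ≤ 3. -/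

import Mathlib

open Finset

/-- The number of edges of `E` containing both vertices `x` and `y`. -/
def hdeg2 {α : Type} [DecidableEq α] (E : Finset (Finset α)) (x y : α) : ℕ :=
  (E.filter (fun e => x ∈ e ∧ y ∈ e)).card

/-- `E` is the edge set of a 4-partite 4-graph with classes `V1, V2, V3, V4`. -/
def IsPartite4 {α : Type} [DecidableEq α] (V1 V2 V3 V4 : Finset α)
    (E : Finset (Finset α)) : Prop :=
  ∀ e ∈ E, e ⊆ V1 ∪ V2 ∪ V3 ∪ V4 ∧ (e ∩ V1).card = 1 ∧ (e ∩ V2).card = 1 ∧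
    (e ∩ V3).card = 1 ∧ (e ∩ V4).card = 1

/-- The edge set of `H'₁,₃(n)` for the choice `W2, W3, W4` of the partition
sets: all quadruples with one vertex in each class that meet `W2 ∪ W3 ∪ W4`
and meet `(V2 \ W2) ∪ (V3 \ W3) ∪ (V4 \ W4)`. -/
def H13edges {α : Type} [DecidableEq α] (V1 V2 V3 V4 W2 W3 W4 : Finset α) :
    Finset (Finset α) :=
  (V1 ∪ V2 ∪ V3 ∪ V4).powerset.filter (fun e =>
    (e ∩ V1).card = 1 ∧ (e ∩ V2).card = 1 ∧ (e ∩ V3).card = 1 ∧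
    (e ∩ V4).card = 1 ∧ (e ∩ (W2 ∪ W3 ∪ W4)).Nonempty ∧
    (e ∩ ((V2 \ W2) ∪ (V3 \ W3) ∪ (V4 \ W4))).Nonempty)

/-- `W2, W3, W4` is a valid choice of partition sets for `H'₁,₃(n)`:
`Wi ⊆ Vi`, `|Wi| ∈ {⌊n/3⌋, ⌈n/3⌉}` and `|W2| + |W3| + |W4| = n`. -/
def IsWChoice {α : Type} [DecidableEq α] (n : ℕ) (V2 V3 V4 W2 W3 W4 : Finset α) :
    Prop :=
  W2 ⊆ V2 ∧ W3 ⊆ V3 ∧ W4 ⊆ V4 ∧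
  (W2.card = n / 3 ∨ W2.card = (n + 2) / 3) ∧
  (W3.card = n / 3 ∨ W3.card = (n + 2) / 3) ∧
  (W4.card = n / 3 ∨ W4.card = (n + 2) / 3) ∧
  W2.card + W3.card + W4.card = n

/-- `H` (with edge set `E`) is `ε`-close to `H'₁,₃(n)`: for some valid choice of
the partition sets `W2, W3, W4`, at most `ε n⁴` edges of `H'₁,₃(n)` are missing
from `E`. -/
def CloseToH13 {α : Type} [DecidableEq α] (ε : ℝ) (n : ℕ)
    (V1 V2 V3 V4 : Finset α) (E : Finset (Finset α)) : Prop :=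
  ∃ W2 W3 W4 : Finset α, IsWChoice n V2 V3 V4 W2 W3 W4 ∧
    (((H13edges V1 V2 V3 V4 W2 W3 W4) \ E).card : ℝ) ≤ ε * n ^ 4


/-- `f` is a fractional perfect matching of the hypergraph with vertex set `V`
and edge set `E`: `f` vanishes off `E`, takes values in `[0,1]`, and the total
weight of the edges at every vertex is exactly `1`. -/
def IsFracPM {α : Type} [DecidableEq α] (V : Finset α) (E : Finset (Finset α))
    (f : Finset α → ℝ) : Prop :=
  (∀ e, e ∉ E → f e = 0) ∧ (∀ e ∈ E, 0 ≤ f e ∧ f e ≤ 1) ∧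
  (∀ v ∈ V, ∑ e ∈ E.filter (fun e => v ∈ e), f e = 1)


lemma numPair (m2 m3 d2 d3 δ η : ℝ) (hd2 : 0 ≤ d2) (hd3 : 0 ≤ d3) (h2 : m2 + d2 ≤ 1)
    (h3 : m3 + d3 ≤ 1) (hm : m2 ≤ m3) (hs : 2 - η ≤ 2 * m2 + m3) (hη0 : 0 ≤ η)
    (hη : η ≤ 1/200) (hδ0 : 0 ≤ δ)
    (hF : m2 * m3 + m2 * d3 + m3 * d2 - 3 * d2 * d3 ≤ 4/9 + δ) :
    m3 ≤ 2/3 + 6 * (δ + η) ∧ d2 + d3 ≤ 11 * (δ + η) := by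
  have hm3 : 2/3 - η/3 ≤ m3 := by linarith
  have hm2 : 1 - η/2 - m3/2 ≤ m2 := by linarith
  have k1 : 0 ≤ (1 - 3/2 * (1 - m3)) * d2 * (1 - m3 - d3) :=
    mul_nonneg (mul_nonneg (by linarith) hd2) (by linarith)
  have k2 : 0 ≤ (3/2 * (1 - m3)) * d3 * (1 - m2 - d2) :=
    mul_nonneg (mul_nonneg (by linarith) hd3) (by linarith)
  have c2 : 1/10 ≤ m3 - 3 * (1 - 3/2 * (1 - m3)) * (1 - m3) := by
    nlinarith [sq_nonneg (m3 - 2/3)]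
  have c3' : 3 * (3/2 * (1 - m3)) * (1 - m2) ≤ 3 * (3/2 * (1 - m3)) * (η/2 + m3/2) :=
    mul_le_mul_of_nonneg_left (by linarith) (by linarith)
  have c3 : 1/10 ≤ m2 - 3 * (3/2 * (1 - m3)) * (1 - m2) := by
    nlinarith [sq_nonneg (m3 - 2/3), mul_nonneg hη0 (by linarith : (0:ℝ) ≤ 1 - m3), mul_nonneg hη0 (by linarith : (0:ℝ) ≤ m3 - 2/3 + η/3)]
  have f1 : m2 * m3 + (d2 + d3) / 10 ≤ 4/9 + δ := by
    have e1 := mul_le_mul_of_nonneg_right c2 hd2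
    have e2 := mul_le_mul_of_nonneg_right c3 hd3
    nlinarith
  have g1 : (1 - η/2 - m3/2) * m3 ≤ m2 * m3 :=
    mul_le_mul_of_nonneg_right hm2 (by linarith)
  have g2 : 4/9 + (m3 - 2/3)/6 - η/10 - η/2 ≤ (1 - η/2 - m3/2) * m3 := by
    nlinarith [mul_nonneg (by linarith : (0:ℝ) ≤ m3 - 2/3 + η/3) (by linarith : (0:ℝ) ≤ 1 - m3), mul_nonneg hη0 (by linarith : (0:ℝ) ≤ 1 - m3), mul_nonneg hη0 (by linarith : (0:ℝ) ≤ m3 - 2/3 + η/3), mul_nonneg hη0 hη0]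
  constructor <;> nlinarith

/-- sorted version -/
lemma numTripleSorted (m1 m2 m3 d1 d2 d3 δ η : ℝ) (hd1 : 0 ≤ d1) (hd2 : 0 ≤ d2) (hd3 : 0 ≤ d3)
    (h1 : m1 + d1 ≤ 1) (h2 : m2 + d2 ≤ 1)
    (h3 : m3 + d3 ≤ 1) (hm12 : m1 ≤ m2) (hm : m2 ≤ m3) (hs : 2 - η ≤ m1 + m2 + m3) (hη0 : 0 ≤ η)
    (hδ0 : 0 ≤ δ) (hσ : δ + η ≤ 1/200)
    (hF : m2 * m3 + m2 * d3 + m3 * d2 - 3 * d2 * d3 ≤ 4/9 + δ)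
    (hF' : m1 * m3 + m1 * d3 + m3 * d1 - 3 * d1 * d3 ≤ 4/9 + δ) :
    (m1 ≤ 2/3 + 6 * (δ + η) ∧ 2/3 - 70 * (δ + η) ≤ m1 - d1) ∧
    (m2 ≤ 2/3 + 6 * (δ + η) ∧ 2/3 - 70 * (δ + η) ≤ m2 - d2) ∧
    (m3 ≤ 2/3 + 6 * (δ + η) ∧ 2/3 - 70 * (δ + η) ≤ m3 - d3) := by
  obtain ⟨a, b⟩ := numPair m2 m3 d2 d3 δ η hd2 hd3 h2 h3 hm (by linarith) hη0 (by linarith) hδ0 hF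
  have l2 : 2/3 - 4 * (δ + η) ≤ m2 := by linarith
  have l1 : 2/3 - 13 * (δ + η) ≤ m1 := by linarith
  have p1 : (2/3 - 13 * (δ + η)) * (2/3 - η/3) ≤ m1 * m3 :=
    mul_le_mul l1 (by linarith) (by linarith) (by linarith)
  have p2 : 0 ≤ m1 * d3 := mul_nonneg (by linarith) hd3
  have p3 : 0 ≤ d1 * (m3 - 3 * d3 - 1/3) := mul_nonneg hd1 (by linarith)
  have p4 : d1 ≤ 57 * (δ + η) := by nlinarith
  refine ⟨⟨?_, ?_⟩, ⟨?_, ?_⟩, ⟨?_, ?_⟩⟩ <;> linarith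

lemma numTriple (l1 l2 l3 h1 h2 h3 δ η : ℝ) (hd1 : l1 ≤ h1) (hd2 : l2 ≤ h2) (hd3 : l3 ≤ h3)
    (e1 : h1 ≤ 1) (e2 : h2 ≤ 1) (e3 : h3 ≤ 1)
    (hs : 2 * (2 - η) ≤ l1 + l2 + l3 + h1 + h2 + h3) (hη0 : 0 ≤ η)
    (hδ0 : 0 ≤ δ) (hσ : δ + η ≤ 1/200)
    (F12 : l1 * h2 + h1 * l2 - l1 * l2 ≤ 4/9 + δ)
    (F13 : l1 * h3 + h1 * l3 - l1 * l3 ≤ 4/9 + δ)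
    (F23 : l2 * h3 + h2 * l3 - l2 * l3 ≤ 4/9 + δ) :
    ((l1 + h1) / 2 ≤ 2/3 + 6 * (δ + η) ∧ 2/3 - 70 * (δ + η) ≤ l1) ∧
    ((l2 + h2) / 2 ≤ 2/3 + 6 * (δ + η) ∧ 2/3 - 70 * (δ + η) ≤ l2) ∧
    ((l3 + h3) / 2 ≤ 2/3 + 6 * (δ + η) ∧ 2/3 - 70 * (δ + η) ≤ l3) := by
  have key : ∀ l1 l2 l3 h1 h2 h3 : ℝ, l1 ≤ h1 → l2 ≤ h2 → l3 ≤ h3 → h1 ≤ 1 → h2 ≤ 1 → h3 ≤ 1 →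
    2 * (2 - η) ≤ l1 + l2 + l3 + h1 + h2 + h3 → l1 * h3 + h1 * l3 - l1 * l3 ≤ 4/9 + δ →
    l2 * h3 + h2 * l3 - l2 * l3 ≤ 4/9 + δ → l1 + h1 ≤ l2 + h2 → l2 + h2 ≤ l3 + h3 →
    ((l1 + h1) / 2 ≤ 2/3 + 6 * (δ + η) ∧ 2/3 - 70 * (δ + η) ≤ l1) ∧
    ((l2 + h2) / 2 ≤ 2/3 + 6 * (δ + η) ∧ 2/3 - 70 * (δ + η) ≤ l2) ∧
    ((l3 + h3) / 2 ≤ 2/3 + 6 * (δ + η) ∧ 2/3 - 70 * (δ + η) ≤ l3) := by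
    intro l1 l2 l3 h1 h2 h3 a1 a2 a3 b1 b2 b3 s f13 f23 o1 o2
    have := numTripleSorted ((l1+h1)/2) ((l2+h2)/2) ((l3+h3)/2) ((h1-l1)/2) ((h2-l2)/2) ((h3-l3)/2)
      δ η (by linarith) (by linarith) (by linarith) (by linarith) (by linarith) (by linarith)
      (by linarith) (by linarith) (by linarith) hη0 hδ0 hσ (by nlinarith) (by nlinarith)
    obtain ⟨⟨x1, y1⟩, ⟨x2, y2⟩, ⟨x3, y3⟩⟩ := this
    refine ⟨⟨?_, ?_⟩, ⟨?_, ?_⟩, ⟨?_, ?_⟩⟩ <;> linarith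
  have F21 : l2 * h1 + h2 * l1 - l2 * l1 ≤ 4/9 + δ := by linarith
  have F31 : l3 * h1 + h3 * l1 - l3 * l1 ≤ 4/9 + δ := by linarith
  have F32 : l3 * h2 + h3 * l2 - l3 * l2 ≤ 4/9 + δ := by linarith
  rcases le_total (l1 + h1) (l2 + h2) with o | o <;>
  rcases le_total (l2 + h2) (l3 + h3) with p | p <;>
  rcases le_total (l1 + h1) (l3 + h3) with q | q
  · exact key l1 l2 l3 h1 h2 h3 hd1 hd2 hd3 e1 e2 e3 hs F13 F23 o p
  · exact key l1 l2 l3 h1 h2 h3 hd1 hd2 hd3 e1 e2 e3 hs F13 F23 o p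
  · have := key l1 l3 l2 h1 h3 h2 hd1 hd3 hd2 e1 e3 e2 (by linarith) F12 F32 q p
    tauto
  · have := key l3 l1 l2 h3 h1 h2 hd3 hd1 hd2 e3 e1 e2 (by linarith) F32 F12 q o
    tauto
  · have := key l2 l1 l3 h2 h1 h3 hd2 hd1 hd3 e2 e1 e3 (by linarith) F23 F13 o q
    tauto
  · have := key l2 l3 l1 h2 h3 h1 hd2 hd3 hd1 e2 e3 e1 (by linarith) F21 F31 p q
    tauto
  · have := key l3 l2 l1 h3 h2 h1 hd3 hd2 hd1 e3 e2 e1 (by linarith) F31 F21 p o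
    tauto
  · have := key l3 l2 l1 h3 h2 h1 hd3 hd2 hd1 e3 e2 e1 (by linarith) F31 F21 p o
    tauto

lemma numUpper (l1 l2 l3 h1 h2 h3 δ : ℝ) (hd1 : l1 ≤ h1) (hd2 : l2 ≤ h2) (hd3 : l3 ≤ h3)
    (e1 : h1 ≤ 1) (e2 : h2 ≤ 1) (e3 : h3 ≤ 1)
    (hδ0 : 0 ≤ δ) (hσ : δ ≤ 1/200)
    (F12 : l1 * h2 + h1 * l2 - l1 * l2 ≤ 4/9 + δ)
    (F13 : l1 * h3 + h1 * l3 - l1 * l3 ≤ 4/9 + δ)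
    (F23 : l2 * h3 + h2 * l3 - l2 * l3 ≤ 4/9 + δ) :
    l1 + l2 + l3 + h1 + h2 + h3 ≤ 4 + 36 * δ := by
  by_contra hc
  push Not at hc
  obtain ⟨⟨x1, y1⟩, ⟨x2, y2⟩, ⟨x3, y3⟩⟩ := numTriple l1 l2 l3 h1 h2 h3 δ 0 hd1 hd2 hd3 e1 e2 e3
    (by linarith) le_rfl hδ0 (by linarith) F12 F13 F23
  linarith

lemma avgLemma (L1 L2 L3 : ℕ → ℝ) (δ κ : ℝ) (M N : ℕ) (hN : N = 4 * M) (hM : 1 ≤ M)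
    (m1 : Monotone L1) (m2 : Monotone L2) (m3 : Monotone L3)
    (b1 : ∀ k, L1 k ≤ 1) (b2 : ∀ k, L2 k ≤ 1) (b3 : ∀ k, L3 k ≤ 1)
    (hδ0 : 0 < δ) (hκ : κ ≤ 1/400) (hδκ : 1000 * δ ≤ κ) (hNκ : 8 ≤ N * κ)
    (F12 : ∀ k, 2 * k ≤ N → L1 k * L2 (N-k) + L1 (N-k) * L2 k - L1 k * L2 k ≤ 4/9 + δ)
    (F13 : ∀ k, 2 * k ≤ N → L1 k * L3 (N-k) + L1 (N-k) * L3 k - L1 k * L3 k ≤ 4/9 + δ)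
    (F23 : ∀ k, 2 * k ≤ N → L2 k * L3 (N-k) + L2 (N-k) * L3 k - L2 k * L3 k ≤ 4/9 + δ)
    (hsum : ∑ k ∈ Icc 1 (N-1), ((1 - L1 k) + (1 - L2 k) + (1 - L3 k)) ≤ N * (1 + 6 * δ)) :
    (∃ k, 1 ≤ k ∧ k ≤ M ∧
      (2/3 - 70 * (δ + κ) ≤ L1 k ∧ L1 k ≤ 2/3 + 6 * (δ + κ)) ∧
      (2/3 - 70 * (δ + κ) ≤ L2 k ∧ L2 k ≤ 2/3 + 6 * (δ + κ)) ∧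
      (2/3 - 70 * (δ + κ) ≤ L3 k ∧ L3 k ≤ 2/3 + 6 * (δ + κ))) ∧
    (N - 1) * (1 - 18 * δ) ≤ ∑ k ∈ Icc 1 (N-1), ((1 - L1 k) + (1 - L2 k) + (1 - L3 k)) := by
  set g : ℕ → ℝ := fun k => (1 - L1 k) + (1 - L2 k) + (1 - L3 k) with hg
  have hrefl : ∑ k ∈ Icc 1 (N-1), g (N - k) = ∑ k ∈ Icc 1 (N-1), g k := by
    apply Finset.sum_nbij' (fun k => N - k) (fun k => N - k)
    · intro k hk; simp only [mem_Icc] at *; omega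
    · intro k hk; simp only [mem_Icc] at *; omega
    · intro k hk; simp only [mem_Icc] at *; omega
    · intro k hk; simp only [mem_Icc] at *; omega
    · intro k hk; rfl
  have hQ0 : ∀ k, 2 * k ≤ N → 2 - 36 * δ ≤ g k + g (N-k) := by
    intro k hk
    have := numUpper (L1 k) (L2 k) (L3 k) (L1 (N-k)) (L2 (N-k)) (L3 (N-k)) δ
      (m1 (by omega)) (m2 (by omega)) (m3 (by omega)) (b1 _) (b2 _) (b3 _) hδ0.le (by linarith)
      (F12 k hk) (F13 k hk) (F23 k hk)
    simp only [hg]; linarith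
  have hQ : ∀ k ∈ Icc 1 (N-1), 2 - 36 * δ ≤ g k + g (N-k) := by
    intro k hk
    simp only [mem_Icc] at hk
    by_cases h : 2 * k ≤ N
    · exact hQ0 k h
    · have := hQ0 (N-k) (by omega)
      rw [show N - (N - k) = k by omega] at this
      linarith
  have hcard : ((Icc 1 (N-1)).card : ℝ) = N - 1 := by
    rw [Nat.card_Icc]; rw [Nat.add_sub_cancel, Nat.cast_sub (by omega)]; simp
  have hdouble : ∑ k ∈ Icc 1 (N-1), (g k + g (N-k)) = 2 * ∑ k ∈ Icc 1 (N-1), g k := by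
    rw [sum_add_distrib, hrefl]; ring
  constructor
  · have : ∃ k, 1 ≤ k ∧ k ≤ M ∧ g k + g (N-k) ≤ 2 + 2 * κ := by
      by_contra hc
      push Not at hc
      have hle : ∑ k ∈ Icc 1 (N-1), ((2 - 36 * δ) + (if k ≤ M then 2 * κ else 0))
          ≤ ∑ k ∈ Icc 1 (N-1), (g k + g (N-k)) := by
        apply sum_le_sum
        intro k hk
        split_ifs with h
        · have := hc k (mem_Icc.1 hk).1 h
          linarith
        · have := hQ k hk; linarith
      rw [hdouble, sum_add_distrib, sum_const, nsmul_eq_mul, hcard, ← sum_filter, sum_const,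
        nsmul_eq_mul] at hle
      have : (Icc 1 (N-1)).filter (fun k => k ≤ M) = Icc 1 M := by
        ext k; simp only [mem_filter, mem_Icc]; omega
      rw [this, Nat.card_Icc, Nat.add_sub_cancel] at hle
      have hNM : (N:ℝ) = 4 * M := by rw [hN]; push_cast; ring
      have h1 : (1:ℝ) ≤ M := by exact_mod_cast hM
      nlinarith
    obtain ⟨k, hk1, hkM, hk⟩ := this
    obtain ⟨⟨x1, y1⟩, ⟨x2, y2⟩, ⟨x3, y3⟩⟩ := numTriple (L1 k) (L2 k) (L3 k) (L1 (N-k)) (L2 (N-k)) (L3 (N-k)) δ κ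
      (m1 (by omega)) (m2 (by omega)) (m3 (by omega)) (b1 _) (b2 _) (b3 _) (by simp only [hg] at hk; linarith)
      (by linarith) hδ0.le (by linarith)
      (F12 k (by omega)) (F13 k (by omega)) (F23 k (by omega))
    have q1 : L1 k ≤ L1 (N-k) := m1 (by omega)
    have q2 : L2 k ≤ L2 (N-k) := m2 (by omega)
    have q3 : L3 k ≤ L3 (N-k) := m3 (by omega)
    exact ⟨k, hk1, hkM, ⟨y1, by linarith⟩, ⟨y2, by linarith⟩, ⟨y3, by linarith⟩⟩
  · have hle := sum_le_sum hQ
    rw [hdouble, sum_const, nsmul_eq_mul, hcard] at hle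
    linarith

/-- Sum of level counts. -/
lemma levelSum {α : Type} (S : Finset α) (w : α → ℝ) (N : ℕ) (hN : 1 ≤ N) (T : ℝ) (hT : 0 < T)
    (hw : ∀ v ∈ S, 0 ≤ w v) :
    ∑ k ∈ Icc 1 (N-1), ((S.filter (fun v => (k:ℝ) * T / N ≤ w v)).card : ℝ) ≤ N / T * ∑ v ∈ S, w v := by
  have hN' : (0:ℝ) < N := by exact_mod_cast hN
  simp only [card_filter, Nat.cast_sum]
  rw [sum_comm, mul_sum]
  apply sum_le_sum
  intro v hv
  rw [← Nat.cast_sum, ← card_filter]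
  have hsub : (Icc 1 (N-1)).filter (fun k : ℕ => (k:ℝ) * T / N ≤ w v) ⊆ Icc 1 ⌊N / T * w v⌋₊ := by
    intro k hk
    simp only [mem_filter, mem_Icc] at hk ⊢
    refine ⟨hk.1.1, Nat.le_floor ?_⟩
    have := hk.2
    rw [div_le_iff₀ hN'] at this
    rw [div_mul_eq_mul_div, le_div_iff₀ hT]
    linarith
  have h1 := card_le_card hsub
  rw [Nat.card_Icc, Nat.add_sub_cancel] at h1
  calc _ ≤ ((⌊N / T * w v⌋₊ : ℕ) : ℝ) := by exact_mod_cast h1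
    _ ≤ _ := Nat.floor_le (mul_nonneg (by positivity) (hw v hv))

lemma pairCount {α : Type} [DecidableEq α] (S S' : Finset α) (w w' : α → ℝ) (n : ℕ)
    (hS : S.card = n) (hS' : S'.card = n) (T T1 T2 : ℝ) (h12 : T1 ≤ T2) (hT : T1 + T2 ≤ T)
    (K : ℕ) (hK : K ≤ ((S ×ˢ S').filter (fun p => T ≤ w p.1 + w' p.2)).card) :
    ((S.filter (fun v => w v < T1)).card : ℝ) * (S'.filter (fun v => w' v < T2)).card
    + (S.filter (fun v => w v < T2)).card * (S'.filter (fun v => w' v < T1)).card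
    - (S.filter (fun v => w v < T1)).card * (S'.filter (fun v => w' v < T1)).card ≤ n^2 - K := by
  set A := (S.filter (fun v => w v < T1)) ×ˢ (S'.filter (fun v => w' v < T2)) with hA
  set B := (S.filter (fun v => w v < T2)) ×ˢ (S'.filter (fun v => w' v < T1)) with hB
  have hAB : A ∩ B = (S.filter (fun v => w v < T1)) ×ˢ (S'.filter (fun v => w' v < T1)) := by
    ext p
    simp only [hA, hB, mem_inter, mem_product, mem_filter]
    constructor
    · tauto
    · rintro ⟨⟨a, b⟩, c, d⟩
      exact ⟨⟨⟨a, b⟩, c, by linarith⟩, ⟨a, by linarith⟩, c, d⟩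
  have hu := card_union_add_card_inter A B
  have hd : Disjoint (A ∪ B) ((S ×ˢ S').filter (fun p => T ≤ w p.1 + w' p.2)) := by
    rw [Finset.disjoint_left]
    intro p hp hq
    simp only [hA, hB, mem_union, mem_product, mem_filter] at hp hq
    rcases hp with ⟨⟨_, a⟩, _, b⟩ | ⟨⟨_, a⟩, _, b⟩ <;> linarith [hq.2]
  have hsub : (A ∪ B) ∪ ((S ×ˢ S').filter (fun p => T ≤ w p.1 + w' p.2)) ⊆ S ×ˢ S' := by
    intro p hp
    simp only [hA, hB, mem_union, mem_product, mem_filter] at hp ⊢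
    tauto
  have h1 := card_le_card hsub
  rw [card_union_of_disjoint hd, card_product, hS, hS'] at h1
  rw [hAB, hA, hB, card_product, card_product, card_product] at hu
  have hu' : (_ : ℝ) = _ := congrArg (Nat.cast : ℕ → ℝ) hu
  have h2 : (((A ∪ B).card + K : ℕ) : ℝ) ≤ ((n * n : ℕ) : ℝ) := by
    exact_mod_cast (by omega)
  push_cast at hu' h2
  nlinarith


lemma frac_or_dual {α : Type} [DecidableEq α] (V : Finset α) (E : Finset (Finset α)) (n : ℕ)
    (hn : 0 < n) (hE : ∀ e ∈ E, e ⊆ V ∧ e.Nonempty) :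
    (∃ f, IsFracPM V E f ∧ (E.filter (fun e => 0 < f e)).card ≤ V.card + 1) ∨
    (∃ (w : α → ℝ) (T : ℝ), (∀ e ∈ E, T ≤ ∑ v ∈ e, w v) ∧ ∑ v ∈ V, w v < n * T) := by
  classical
  have hn' : (0:ℝ) < n := by exact_mod_cast hn
  let χ : Finset α → (V → ℝ) := fun e v => if v.1 ∈ e then 1 else 0
  let p : V → ℝ := fun _ => 1 / n
  by_cases hp : p ∈ convexHull ℝ (χ '' (E : Set (Finset α)))
  · left
    obtain ⟨ι, _, z, c, hz, haff, hc, hc1, hcz⟩ := eq_pos_convex_span_of_mem_convexHull hp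
    have : ∀ i, ∃ e ∈ E, χ e = z i := fun i => by
      obtain ⟨e, he, h⟩ := hz ⟨i, rfl⟩
      exact ⟨e, he, h⟩
    choose e heE hez using this
    let f : Finset α → ℝ := fun x => ∑ i, if e i = x then n * c i else 0
    have hf0 : ∀ x, 0 ≤ f x := fun x => sum_nonneg fun i _ => by
      split_ifs
      · exact mul_nonneg hn'.le (hc i).le
      · exact le_rfl
    have hv : ∀ v ∈ V, ∑ x ∈ E.filter (fun x => v ∈ x), f x = 1 := by
      intro v hv
      simp only [f]
      rw [sum_comm]
      have h1 : ∀ i, ∑ x ∈ E.filter (fun x => v ∈ x), (if e i = x then n * c i else 0)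
          = n * (c i * z i ⟨v, hv⟩) := by
        intro i
        rw [Finset.sum_ite_eq]
        rw [← hez i]
        simp only [χ, mem_filter, heE i, true_and]
        split_ifs <;> ring
      simp only [h1]
      rw [← mul_sum]
      have h2 := congrFun hcz ⟨v, hv⟩
      simp only [Finset.sum_apply, Pi.smul_apply, smul_eq_mul, p] at h2
      rw [h2]
      field_simp
    refine ⟨f, ⟨?_, ?_, hv⟩, ?_⟩
    · intro x hx
      apply sum_eq_zero
      intro i _
      rw [if_neg]
      rintro rfl
      exact hx (heE i)
    · intro x hx
      refine ⟨hf0 x, ?_⟩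
      obtain ⟨v, hvx⟩ := (hE x hx).2
      rw [← hv v ((hE x hx).1 hvx)]
      exact single_le_sum (f := f) (fun y _ => hf0 y) (mem_filter.2 ⟨hx, hvx⟩)
    · have hsub : E.filter (fun x => 0 < f x) ⊆ univ.image e := by
        intro x hx
        by_contra hne
        have : f x = 0 := by
          apply sum_eq_zero
          intro i _
          rw [if_neg]
          rintro rfl
          exact hne (mem_image_of_mem _ (mem_univ i))
        have h2 := (mem_filter.1 hx).2
        linarith
      calc _ ≤ _ := card_le_card hsub
        _ ≤ _ := card_image_le
        _ = Fintype.card ι := rfl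
        _ ≤ Module.finrank ℝ (vectorSpan ℝ (Set.range z)) + 1 := haff.card_le_finrank_succ
        _ ≤ Module.finrank ℝ (V → ℝ) + 1 := by
            gcongr; exact Submodule.finrank_le _
        _ = _ := by simp
  · right
    have hcl : IsClosed (convexHull ℝ (χ '' (E : Set (Finset α)))) :=
      (E.finite_toSet.image χ).isClosed_convexHull ℝ
    obtain ⟨g, u, hg1, hg2⟩ := geometric_hahn_banach_point_closed (convex_convexHull ℝ _) hcl hp
    have hrep : ∀ y : V → ℝ, g y = ∑ v : V, y v * g (Pi.single v 1) := by
      intro y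
      conv_lhs => rw [pi_eq_sum_univ' y]
      rw [map_sum]
      apply sum_congr rfl
      intro v _
      rw [map_smul, smul_eq_mul]
    let w : α → ℝ := fun v => if h : v ∈ V then g (Pi.single ⟨v, h⟩ 1) else 0
    have hw : ∀ v : V, w v.1 = g (Pi.single v 1) := fun v => by simp [w]
    refine ⟨w, u, ?_, ?_⟩
    · intro e he
      have h1 := hg2 (χ e) (subset_convexHull ℝ _ ⟨e, he, rfl⟩)
      rw [hrep] at h1
      have : ∑ v : V, χ e v * g (Pi.single v 1) = ∑ v ∈ e, w v := by
        simp only [← hw, χ, ite_mul, one_mul, zero_mul]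
        rw [Finset.sum_coe_sort V (fun v => if v ∈ e then w v else 0), ← sum_filter]
        congr 1
        ext v; simp only [mem_filter]
        exact ⟨fun h => h.2, fun h => ⟨(hE e he).1 h, h⟩⟩
      linarith
    · rw [hrep] at hg1
      simp only [p, ← hw] at hg1
      rw [← mul_sum, Finset.sum_coe_sort V w, one_div, inv_mul_lt_iff₀ hn'] at hg1
      exact hg1

section partite
variable {α : Type} [DecidableEq α] {V1 V2 V3 V4 : Finset α} {E : Finset (Finset α)}

lemma IsPartite4.exists_eq (h : IsPartite4 V1 V2 V3 V4 E) {e : Finset α} (he : e ∈ E) :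
    ∃ a ∈ V1, ∃ b ∈ V2, ∃ c ∈ V3, ∃ d ∈ V4, e = {a, b, c, d} := by
  obtain ⟨h0, h1, h2, h3, h4⟩ := h e he
  obtain ⟨a, ha⟩ := card_eq_one.1 h1
  obtain ⟨b, hb⟩ := card_eq_one.1 h2
  obtain ⟨c, hc⟩ := card_eq_one.1 h3
  obtain ⟨d, hd⟩ := card_eq_one.1 h4
  have ha' : a ∈ e ∩ V1 := by rw [ha]; simp
  have hb' : b ∈ e ∩ V2 := by rw [hb]; simp
  have hc' : c ∈ e ∩ V3 := by rw [hc]; simp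
  have hd' : d ∈ e ∩ V4 := by rw [hd]; simp
  rw [mem_inter] at ha' hb' hc' hd'
  refine ⟨a, ha'.2, b, hb'.2, c, hc'.2, d, hd'.2, ?_⟩
  ext v
  simp only [mem_insert, mem_singleton]
  constructor
  · intro hv
    have := h0 hv
    simp only [mem_union] at this
    rcases this with ((h | h) | h) | h
    · have : v ∈ e ∩ V1 := mem_inter.2 ⟨hv, h⟩
      rw [ha, mem_singleton] at this; tauto
    · have : v ∈ e ∩ V2 := mem_inter.2 ⟨hv, h⟩
      rw [hb, mem_singleton] at this; tauto
    · have : v ∈ e ∩ V3 := mem_inter.2 ⟨hv, h⟩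
      rw [hc, mem_singleton] at this; tauto
    · have : v ∈ e ∩ V4 := mem_inter.2 ⟨hv, h⟩
      rw [hd, mem_singleton] at this; tauto
  · rintro (h | h | h | h) <;> subst h <;> tauto

lemma IsPartite4.mono (h : IsPartite4 V1 V2 V3 V4 E) {E' : Finset (Finset α)} (hE : E' ⊆ E) :
    IsPartite4 V1 V2 V3 V4 E' := fun e he => h e (hE he)

lemma IsPartite4.perm3 (h : IsPartite4 V1 V2 V3 V4 E) : IsPartite4 V1 V3 V2 V4 E := by
  intro e he
  obtain ⟨h0, h1, h2, h3, h4⟩ := h e he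
  refine ⟨fun v hv => ?_, h1, h3, h2, h4⟩
  have := h0 hv
  simp only [mem_union] at this ⊢
  tauto

lemma IsPartite4.perm4 (h : IsPartite4 V1 V2 V3 V4 E) : IsPartite4 V1 V4 V2 V3 E := by
  intro e he
  obtain ⟨h0, h1, h2, h3, h4⟩ := h e he
  refine ⟨fun v hv => ?_, h1, h4, h2, h3⟩
  have := h0 hv
  simp only [mem_union] at this ⊢
  tauto

/-- an edge containing `x ∈ V1` and `y ∈ V2` -/
lemma IsPartite4.exists_eq2 (h : IsPartite4 V1 V2 V3 V4 E) {e : Finset α} (he : e ∈ E) {x y : α}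
    (hx : x ∈ V1) (hy : y ∈ V2) (hxe : x ∈ e) (hye : y ∈ e) :
    ∃ c ∈ V3, ∃ d ∈ V4, e = {x, y, c, d} := by
  obtain ⟨a, ha, b, hb, c, hc, d, hd, rfl⟩ := h.exists_eq he
  obtain ⟨h0, h1, h2, h3, h4⟩ := h _ he
  have hax : a = x := by
    have := card_le_one.1 h1.le
    exact this a (by simp [ha]) x (mem_inter.2 ⟨hxe, hx⟩)
  have hby : b = y := by
    have := card_le_one.1 h2.le
    exact this b (by simp [hb]) y (mem_inter.2 ⟨hye, hy⟩)
  subst hax hby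
  exact ⟨c, hc, d, hd, rfl⟩

lemma hdeg2_le (h : IsPartite4 V1 V2 V3 V4 E) {x y : α} (hx : x ∈ V1) (hy : y ∈ V2) :
    hdeg2 E x y ≤ ((V3 ×ˢ V4).filter (fun p => ({x, y, p.1, p.2} : Finset α) ∈ E)).card := by
  have : E.filter (fun e => x ∈ e ∧ y ∈ e) ⊆
      ((V3 ×ˢ V4).filter (fun p => ({x, y, p.1, p.2} : Finset α) ∈ E)).image
        (fun p => ({x, y, p.1, p.2} : Finset α)) := by
    intro e he
    obtain ⟨heE, hxe, hye⟩ := mem_filter.1 he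
    obtain ⟨c, hc, d, hd, rfl⟩ := h.exists_eq2 heE hx hy hxe hye
    exact mem_image.2 ⟨(c, d), mem_filter.2 ⟨mem_product.2 ⟨hc, hd⟩, heE⟩, rfl⟩
  exact (card_le_card this).trans card_image_le

/-- same, with a predicate implied by the edges -/
lemma hdeg2_le_pred (h : IsPartite4 V1 V2 V3 V4 E) {x y : α} (hx : x ∈ V1) (hy : y ∈ V2)
    (P : α × α → Prop) [DecidablePred P]
    (hP : ∀ c ∈ V3, ∀ d ∈ V4, ({x, y, c, d} : Finset α) ∈ E → P (c, d)) :
    hdeg2 E x y ≤ ((V3 ×ˢ V4).filter P).card := by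
  refine (hdeg2_le h hx hy).trans (card_le_card ?_)
  intro p hp
  simp only [mem_filter, mem_product] at hp ⊢
  exact ⟨hp.1, hP _ hp.1.1 _ hp.1.2 hp.2⟩

lemma exists_shift (V : Finset α) (n : ℕ) (hn : 0 < n) (hV : V.card = n) (w : α → ℝ) :
    ∃ u ∈ V, ∀ v ∈ V, w u ≤ w v :=
  exists_min_image V w (card_pos.1 (by omega))

lemma dual_normalize (d12 : Disjoint V1 V2) (d13 : Disjoint V1 V3) (d14 : Disjoint V1 V4)
    (d23 : Disjoint V2 V3) (d24 : Disjoint V2 V4) (d34 : Disjoint V3 V4) (n : ℕ) (hn : 0 < n)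
    (c1 : V1.card = n) (c2 : V2.card = n) (c3 : V3.card = n) (c4 : V4.card = n)
    (w : α → ℝ) (T : ℝ) (hw : ∀ e ∈ E, T ≤ ∑ v ∈ e, w v)
    (htot : ∑ v ∈ V1 ∪ V2 ∪ V3 ∪ V4, w v < n * T) :
    ∃ w1 w2 w3 w4 : α → ℝ, (∀ v ∈ V1, 0 ≤ w1 v) ∧ (∀ v ∈ V2, 0 ≤ w2 v) ∧ (∀ v ∈ V3, 0 ≤ w3 v) ∧
      (∀ v ∈ V4, 0 ≤ w4 v) ∧ (∃ u ∈ V1, w1 u = 0) ∧ (∃ u ∈ V2, w2 u = 0) ∧ (∃ u ∈ V3, w3 u = 0) ∧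
      (∃ u ∈ V4, w4 u = 0) ∧
      (∀ a ∈ V1, ∀ b ∈ V2, ∀ c ∈ V3, ∀ d ∈ V4, ({a, b, c, d} : Finset α) ∈ E →
        1 ≤ w1 a + w2 b + w3 c + w4 d) ∧
      ∑ v ∈ V1, w1 v + ∑ v ∈ V2, w2 v + ∑ v ∈ V3, w3 v + ∑ v ∈ V4, w4 v < n := by
  obtain ⟨u1, hu1, m1⟩ := exists_shift V1 n hn c1 w
  obtain ⟨u2, hu2, m2⟩ := exists_shift V2 n hn c2 w
  obtain ⟨u3, hu3, m3⟩ := exists_shift V3 n hn c3 w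
  obtain ⟨u4, hu4, m4⟩ := exists_shift V4 n hn c4 w
  have hn' : (0:ℝ) < n := by exact_mod_cast hn
  rw [sum_union (by simp only [disjoint_union_left]; tauto), sum_union (by simp only [disjoint_union_left]; tauto),
    sum_union d12] at htot
  set T' := T - w u1 - w u2 - w u3 - w u4 with hT'
  have s : ∀ (V : Finset α) (hc : V.card = n) (u : α), ∑ v ∈ V, (w v - w u) / T' = (∑ v ∈ V, w v - n * w u) / T' := by
    intro V hc u
    rw [← sum_div, sum_sub_distrib, sum_const, hc, nsmul_eq_mul]
  have nn : ∀ (V : Finset α) (hc : V.card = n) (u : α) (hm : ∀ v ∈ V, w u ≤ w v), n * w u ≤ ∑ v ∈ V, w v := by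
    intro V hc u hm
    have := sum_le_sum hm
    rwa [sum_const, hc, nsmul_eq_mul] at this
  have n1 := nn V1 c1 u1 m1
  have n2 := nn V2 c2 u2 m2
  have n3 := nn V3 c3 u3 m3
  have n4 := nn V4 c4 u4 m4
  have hTpos : 0 < T' := by
    have : 0 < n * T' := by rw [hT']; nlinarith
    exact (mul_pos_iff_of_pos_left hn').1 this
  refine ⟨fun v => (w v - w u1) / T', fun v => (w v - w u2) / T', fun v => (w v - w u3) / T',
    fun v => (w v - w u4) / T', fun v hv => div_nonneg (by linarith [m1 v hv]) hTpos.le,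
    fun v hv => div_nonneg (by linarith [m2 v hv]) hTpos.le,
    fun v hv => div_nonneg (by linarith [m3 v hv]) hTpos.le,
    fun v hv => div_nonneg (by linarith [m4 v hv]) hTpos.le,
    ⟨u1, hu1, by simp⟩, ⟨u2, hu2, by simp⟩, ⟨u3, hu3, by simp⟩, ⟨u4, hu4, by simp⟩, ?_, ?_⟩
  · intro a ha b hb c hc d hd he
    have := hw _ he
    have nab : a ≠ b := fun h => Finset.disjoint_left.1 d12 ha (h ▸ hb)
    have nac : a ≠ c := fun h => Finset.disjoint_left.1 d13 ha (h ▸ hc)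
    have nad : a ≠ d := fun h => Finset.disjoint_left.1 d14 ha (h ▸ hd)
    have nbc : b ≠ c := fun h => Finset.disjoint_left.1 d23 hb (h ▸ hc)
    have nbd : b ≠ d := fun h => Finset.disjoint_left.1 d24 hb (h ▸ hd)
    have ncd : c ≠ d := fun h => Finset.disjoint_left.1 d34 hc (h ▸ hd)
    rw [sum_insert (by simp [nab, nac, nad]), sum_insert (by simp [nbc, nbd]),
      sum_insert (by simp [ncd]), sum_singleton] at this
    simp only
    rw [← add_div, ← add_div, ← add_div, le_div_iff₀ hTpos, hT']
    linarith
  · rw [s V1 c1, s V2 c2, s V3 c3, s V4 c4, ← add_div, ← add_div, ← add_div, div_lt_iff₀ hTpos, hT']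
    linarith

end partite


section close
variable {α : Type} [DecidableEq α]

lemma exists_near (V W : Finset α) (hW : W ⊆ V) (s : ℕ) (hs : s ≤ V.card) :
    ∃ W', W' ⊆ V ∧ W'.card = s ∧ (((W \ W') ∪ (W' \ W)).card : ℝ) ≤ |(W.card : ℝ) - s| := by
  rcases le_total s W.card with h | h
  · obtain ⟨W', h1, h2⟩ := exists_subset_card_eq h
    refine ⟨W', h1.trans hW, h2, ?_⟩
    rw [sdiff_eq_empty_iff_subset.2 h1, union_empty, card_sdiff_of_subset h1, h2, Nat.cast_sub h]
    exact le_abs_self _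
  · obtain ⟨W', h1, h2, h3⟩ := exists_subsuperset_card_eq hW h hs
    refine ⟨W', h2, h3, ?_⟩
    rw [sdiff_eq_empty_iff_subset.2 h1, empty_union, card_sdiff_of_subset h1, h3, Nat.cast_sub h]
    rw [abs_sub_comm]
    exact le_abs_self _

lemma classCount {V1 Y C D : Finset α} {E : Finset (Finset α)} (n : ℕ) (δ τ : ℝ)
    (hτ : 0 ≤ τ) (hτ1 : τ ≤ 1/3) (hδ : 0 ≤ δ)
    (c1 : V1.card = n) (cY : Y.card = n) (cC : C.card = n) (cD : D.card = n)
    (hE : IsPartite4 V1 Y C D E) (Bad : α → α → Prop)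
    (hbad : ∀ x ∈ V1, ∃ B : Finset α, (B.card : ℝ) ≤ δ * n ∧ ∀ y ∈ Y, Bad x y → y ∈ B)
    (hdeg : ∀ x ∈ V1, ∀ y ∈ Y, ¬ Bad x y → (5/9 - δ) * n^2 ≤ (hdeg2 E x y : ℝ))
    (X Δ UY UC UD : Finset α) (hX : X ⊆ V1) (hUY : UY ⊆ Y) (hUC : UC ⊆ C) (hUD : UD ⊆ D)
    (hΔ : (Δ.card : ℝ) ≤ 2 * τ * n)
    (lC : (2/3 - τ) * n ≤ (UC.card : ℝ)) (lD : (2/3 - τ) * n ≤ (UD.card : ℝ))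
    (hno : ∀ x ∈ X, ∀ y ∈ UY, ∀ c ∈ UC, ∀ d ∈ UD, ({x, y, c, d} : Finset α) ∉ E)
    (M : Finset (Finset α))
    (hM : ∀ e ∈ M, ∃ x ∈ V1, ∃ y ∈ Y, ∃ c ∈ C, ∃ d ∈ D, e = {x, y, c, d} ∧
      (Bad x y ∨ y ∈ Δ ∨ (x ∈ X ∧ y ∈ UY ∧ ¬ (c ∈ UC ∧ d ∈ UD) ∧ e ∉ E))) :
    (M.card : ℝ) ≤ (2 * δ + 2 * τ + 4/3 * τ) * n^4 := by
  classical
  let P := (V1 ×ˢ Y).filter (fun p => Bad p.1 p.2)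
  let F : (α × α) × (α × α) → Finset α := fun t => {t.1.1, t.1.2, t.2.1, t.2.2}
  let M1 := (P ×ˢ (C ×ˢ D)).image F
  let M2 := ((V1 ×ˢ Δ) ×ˢ (C ×ˢ D)).image F
  let G : α × α → Finset (α × α) := fun p => (C ×ˢ D).filter (fun q => ¬ (q.1 ∈ UC ∧ q.2 ∈ UD) ∧
    F (p, q) ∉ E)
  let M3 := ((X ×ˢ UY).filter (fun p => ¬ Bad p.1 p.2)).biUnion (fun p => (G p).image (fun q => F (p, q)))
  have hsub : M ⊆ (M1 ∪ M2) ∪ M3 := by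
    intro e he
    obtain ⟨x, hx, y, hy, c, hc, d, hd, heq, h⟩ := hM e he
    simp only [mem_union]
    by_cases hb : Bad x y
    · left; left
      exact mem_image.2 ⟨((x, y), (c, d)), by simp [P, hx, hy, hc, hd, hb], heq.symm⟩
    rcases h with h | h | ⟨h1, h2, h3, h4⟩
    · exact absurd h hb
    · left; right
      exact mem_image.2 ⟨((x, y), (c, d)), by simp [hx, hc, hd, h], heq.symm⟩
    · right
      refine mem_biUnion.2 ⟨(x, y), by simp [h1, h2, hb], mem_image.2 ⟨(c, d), ?_, heq.symm⟩⟩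
      refine mem_filter.2 ⟨by simp [hc, hd], h3, ?_⟩
      rw [heq] at h4
      exact h4
  have hn : (0:ℝ) ≤ n := Nat.cast_nonneg n
  have hP : (P.card : ℝ) ≤ n * (δ * n) := by
    have : P.card = ∑ x ∈ V1, (Y.filter (fun y => Bad x y)).card := by
      simp only [P, card_filter]
      rw [sum_product]
    rw [this, Nat.cast_sum]
    calc _ ≤ ∑ x ∈ V1, (δ * n) := by
          apply sum_le_sum
          intro x hx
          obtain ⟨B, hB, hB2⟩ := hbad x hx
          refine le_trans ?_ hB
          exact_mod_cast card_le_card (fun y hy => hB2 y (mem_filter.1 hy).1 (mem_filter.1 hy).2)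
      _ = _ := by rw [sum_const, c1, nsmul_eq_mul]
  have hM1 : (M1.card : ℝ) ≤ δ * n^4 := by
    have : M1.card ≤ P.card * (n * n) := by
      refine card_image_le.trans ?_
      rw [card_product, card_product, cC, cD]
    calc (M1.card : ℝ) ≤ P.card * (n * n) := by exact_mod_cast this
      _ ≤ (n * (δ * n)) * (n * n) := by gcongr
      _ = _ := by ring
  have hM2 : (M2.card : ℝ) ≤ 2 * τ * n^4 := by
    have : M2.card ≤ (n * Δ.card) * (n * n) := by
      refine card_image_le.trans ?_
      rw [card_product, card_product, card_product, cC, cD, c1]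
    calc (M2.card : ℝ) ≤ (n * Δ.card) * (n * n) := by exact_mod_cast this
      _ ≤ (n * (2 * τ * n)) * (n * n) := by gcongr
      _ = _ := by ring
  have hM3 : (M3.card : ℝ) ≤ (4/3 * τ + δ) * n^4 := by
    have h1 : (M3.card : ℝ) ≤ ∑ p ∈ (X ×ˢ UY).filter (fun p => ¬ Bad p.1 p.2), ((G p).card : ℝ) := by
      have : M3.card ≤ ∑ p ∈ (X ×ˢ UY).filter (fun p => ¬ Bad p.1 p.2), (G p).card :=
        card_biUnion_le.trans (sum_le_sum fun p _ => card_image_le)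
      exact_mod_cast this
    have hK : 0 ≤ (4/3 * τ + δ) * (n:ℝ)^2 := by positivity
    have h2 : ∀ p ∈ (X ×ˢ UY).filter (fun p => ¬ Bad p.1 p.2), ((G p).card : ℝ) ≤ (4/3 * τ + δ) * n^2 := by
      rintro ⟨x, y⟩ hp
      simp only [mem_filter, mem_product] at hp
      obtain ⟨⟨hx, hy⟩, hb⟩ := hp
      have hd := hdeg x (hX hx) y (hUY hy) hb
      have hdle := hdeg2_le hE (hX hx) (hUY hy)
      set A := (C ×ˢ D).filter (fun p => ({x, y, p.1, p.2} : Finset α) ∈ E) with hA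
      have dis1 : Disjoint (G (x, y)) A := by
        rw [Finset.disjoint_left]
        intro q hq hqA
        exact (mem_filter.1 hq).2.2 (mem_filter.1 hqA).2
      have dis2 : Disjoint (G (x, y) ∪ A) (UC ×ˢ UD) := by
        rw [Finset.disjoint_left]
        intro q hq hqU
        rw [mem_product] at hqU
        rcases mem_union.1 hq with h | h
        · exact (mem_filter.1 h).2.1 hqU
        · exact hno x hx y hy _ hqU.1 _ hqU.2 (mem_filter.1 h).2
      have hs : (G (x, y) ∪ A) ∪ (UC ×ˢ UD) ⊆ C ×ˢ D := by
        intro q hq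
        rcases mem_union.1 hq with h | h
        · rcases mem_union.1 h with h | h
          · exact (mem_filter.1 h).1
          · exact (mem_filter.1 h).1
        · rw [mem_product] at h ⊢
          exact ⟨hUC h.1, hUD h.2⟩
      have h3 := card_le_card hs
      rw [card_union_of_disjoint dis2, card_union_of_disjoint dis1, card_product, card_product, cC, cD] at h3
      have h4 : ((G (x,y)).card : ℝ) + A.card + UC.card * UD.card ≤ n * n := by exact_mod_cast h3
      have h5 : (hdeg2 E x y : ℝ) ≤ A.card := by exact_mod_cast hdle
      have h6 : ((2/3 - τ) * n) * ((2/3 - τ) * n) ≤ (UC.card : ℝ) * UD.card :=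
        mul_le_mul lC lD (mul_nonneg (by linarith) hn) (by positivity)
      nlinarith [mul_nonneg (mul_nonneg hτ hτ) (mul_nonneg hn hn)]
    have h3 := h1.trans (sum_le_card_nsmul _ _ _ h2)
    rw [nsmul_eq_mul] at h3
    have h4 : (((X ×ˢ UY).filter (fun p => ¬ Bad p.1 p.2)).card : ℝ) ≤ n * n := by
      have : ((X ×ˢ UY).filter (fun p => ¬ Bad p.1 p.2)).card ≤ n * n := by
        refine (card_filter_le _ _).trans ?_
        rw [card_product]
        exact Nat.mul_le_mul (c1 ▸ card_le_card hX) (cY ▸ card_le_card hUY)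
      exact_mod_cast this
    calc _ ≤ _ := h3
      _ ≤ (n * n) * ((4/3 * τ + δ) * n^2) := by gcongr
      _ = _ := by ring
  have hcard : M.card ≤ M1.card + M2.card + M3.card :=
    (card_le_card hsub).trans ((card_union_le _ _).trans (Nat.add_le_add_right (card_union_le _ _) _))
  have : (M.card : ℝ) ≤ M1.card + M2.card + M3.card := by exact_mod_cast hcard
  linarith

lemma H13_partite (V1 V2 V3 V4 W2 W3 W4 : Finset α) :
    IsPartite4 V1 V2 V3 V4 (H13edges V1 V2 V3 V4 W2 W3 W4) := by
  intro e he
  simp only [H13edges, mem_filter, mem_powerset] at he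
  tauto

set_option maxHeartbeats 1000000 in
lemma close_of_cover {V1 V2 V3 V4 : Finset α} {E : Finset (Finset α)} (n : ℕ) (δ τ ε : ℝ)
    (hτ : 0 ≤ τ) (hτ1 : τ ≤ 1/3) (hδ : 0 ≤ δ) (hδτ : 6 * δ ≤ τ) (hε : 12 * τ ≤ ε) (hn : 1 ≤ τ * n)
    (c1 : V1.card = n) (c2 : V2.card = n) (c3 : V3.card = n) (c4 : V4.card = n)
    (hE : IsPartite4 V1 V2 V3 V4 E) (Bad : α → α → Prop)
    (hbad : ∀ x ∈ V1, ∃ B : Finset α, (B.card : ℝ) ≤ δ * n ∧ ∀ y ∈ V2 ∪ V3 ∪ V4, Bad x y → y ∈ B)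
    (hdeg : ∀ x ∈ V1, ∀ y ∈ V2 ∪ V3 ∪ V4, ¬ Bad x y → (5/9 - δ) * n^2 ≤ (hdeg2 E x y : ℝ))
    (X U2 U3 U4 : Finset α) (hX : X ⊆ V1) (hU2 : U2 ⊆ V2) (hU3 : U3 ⊆ V3) (hU4 : U4 ⊆ V4)
    (hXc : ((V1 \ X).card : ℝ) ≤ τ * n)
    (l2 : (2/3 - τ) * n ≤ (U2.card : ℝ)) (l3 : (2/3 - τ) * n ≤ (U3.card : ℝ))
    (l4 : (2/3 - τ) * n ≤ (U4.card : ℝ))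
    (r2 : (U2.card : ℝ) ≤ (2/3 + τ) * n) (r3 : (U3.card : ℝ) ≤ (2/3 + τ) * n)
    (r4 : (U4.card : ℝ) ≤ (2/3 + τ) * n)
    (hno : ∀ x ∈ X, ∀ y ∈ U2, ∀ c ∈ U3, ∀ d ∈ U4, ({x, y, c, d} : Finset α) ∉ E) :
    CloseToH13 ε n V1 V2 V3 V4 E := by
  classical
  have near : ∀ (V U : Finset α) (s : ℕ), V.card = n → U ⊆ V → (2/3 - τ) * n ≤ (U.card : ℝ) →
      (U.card : ℝ) ≤ (2/3 + τ) * n → n ≤ 3 * s + 2 → 3 * s ≤ n + 2 →  s ≤ n →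
      ∃ W', W' ⊆ V ∧ W'.card = s ∧ (((V \ U) \ W' ∪ W' \ (V \ U)).card : ℝ) ≤ 2 * τ * n := by
    intro V U s hV hU a b h1 h2 h3
    obtain ⟨W', p, q, r⟩ := exists_near V (V \ U) sdiff_subset s (by omega)
    refine ⟨W', p, q, r.trans ?_⟩
    rw [card_sdiff_of_subset hU, Nat.cast_sub (card_le_card hU), hV]
    have h1' : (n:ℝ) ≤ 3 * s + 2 := by exact_mod_cast h1
    have h2' : (3:ℝ) * s ≤ n + 2 := by exact_mod_cast h2
    rw [abs_le]; constructor <;> nlinarith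
  obtain ⟨W2, w2, s2, D2⟩ := near V2 U2 (n/3) c2 hU2 l2 r2 (by omega) (by omega) (by omega)
  obtain ⟨W3, w3, s3, D3⟩ := near V3 U3 ((n+1)/3) c3 hU3 l3 r3 (by omega) (by omega) (by omega)
  obtain ⟨W4, w4, s4, D4⟩ := near V4 U4 ((n+2)/3) c4 hU4 l4 r4 (by omega) (by omega) (by omega)
  refine ⟨W2, W3, W4, ⟨w2, w3, w4, by omega, by omega, by omega, by omega⟩, ?_⟩
  set Δ2 := (V2 \ U2) \ W2 ∪ W2 \ (V2 \ U2) with hΔ2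
  set Δ3 := (V3 \ U3) \ W3 ∪ W3 \ (V3 \ U3) with hΔ3
  set Δ4 := (V4 \ U4) \ W4 ∪ W4 \ (V4 \ U4) with hΔ4
  set M := (H13edges V1 V2 V3 V4 W2 W3 W4) \ E with hM
  let Q : Finset α → Finset α → Finset α → Finset α → Finset α → Finset α → Finset α → Finset α → Prop :=
    fun Y C D Δ UY UC UD e => ∃ x ∈ V1, ∃ y ∈ Y, ∃ c ∈ C, ∃ d ∈ D, e = {x, y, c, d} ∧
      (Bad x y ∨ y ∈ Δ ∨ (x ∈ X ∧ y ∈ UY ∧ ¬ (c ∈ UC ∧ d ∈ UD) ∧ e ∉ E))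
  let M0 := ((V1 \ X) ×ˢ (V2 ×ˢ (V3 ×ˢ V4))).image (fun t => ({t.1, t.2.1, t.2.2.1, t.2.2.2} : Finset α))
  let M2 := M.filter (Q V2 V3 V4 Δ2 U2 U3 U4)
  let M3 := M.filter (Q V3 V2 V4 Δ3 U3 U2 U4)
  let M4 := M.filter (Q V4 V2 V3 Δ4 U4 U2 U3)
  have pc : ∀ a b c d : α, ({a, b, c, d} : Finset α) = {a, c, b, d} := by
    intro a b c d; ext v; simp only [mem_insert, mem_singleton]; tauto
  have pd : ∀ a b c d : α, ({a, b, c, d} : Finset α) = {a, d, b, c} := by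
    intro a b c d; ext v; simp only [mem_insert, mem_singleton]; tauto
  have hsub : M ⊆ ((M0 ∪ M2) ∪ M3) ∪ M4 := by
    intro e he
    obtain ⟨heH, heE⟩ := mem_sdiff.1 he
    obtain ⟨a, ha, b, hb, c, hc, d, hd, heq⟩ := (H13_partite V1 V2 V3 V4 W2 W3 W4).exists_eq heH
    simp only [H13edges, mem_filter, mem_powerset] at heH
    obtain ⟨-, -, k2, k3, k4, ⟨p, hp⟩, ⟨q, hq⟩⟩ := heH
    have un2 : ∀ v ∈ e, v ∈ V2 → v = b := fun v hv hv2 =>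
      card_le_one.1 k2.le v (mem_inter.2 ⟨hv, hv2⟩) b (mem_inter.2 ⟨by simp [heq], hb⟩)
    have un3 : ∀ v ∈ e, v ∈ V3 → v = c := fun v hv hv2 =>
      card_le_one.1 k3.le v (mem_inter.2 ⟨hv, hv2⟩) c (mem_inter.2 ⟨by simp [heq], hc⟩)
    have un4 : ∀ v ∈ e, v ∈ V4 → v = d := fun v hv hv2 =>
      card_le_one.1 k4.le v (mem_inter.2 ⟨hv, hv2⟩) d (mem_inter.2 ⟨by simp [heq], hd⟩)
    have hW : b ∈ W2 ∨ c ∈ W3 ∨ d ∈ W4 := by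
      simp only [mem_inter, mem_union] at hp
      obtain ⟨hpe, (h | h) | h⟩ := hp
      · left; rw [← un2 p hpe (w2 h)]; exact h
      · right; left; rw [← un3 p hpe (w3 h)]; exact h
      · right; right; rw [← un4 p hpe (w4 h)]; exact h
    have hU : b ∉ W2 ∨ c ∉ W3 ∨ d ∉ W4 := by
      simp only [mem_inter, mem_union, mem_sdiff] at hq
      obtain ⟨hpe, (h | h) | h⟩ := hq
      · left; rw [← un2 q hpe h.1]; exact h.2
      · right; left; rw [← un3 q hpe h.1]; exact h.2
      · right; right; rw [← un4 q hpe h.1]; exact h.2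
    by_cases haX : a ∈ X
    swap
    · simp only [mem_union]; left; left; left
      exact mem_image.2 ⟨(a, b, c, d), by simp [ha, haX, hb, hc, hd], heq.symm⟩
    have toM2 : (b ∈ Δ2 ∨ (b ∈ U2 ∧ ¬ (c ∈ U3 ∧ d ∈ U4))) → e ∈ ((M0 ∪ M2) ∪ M3) ∪ M4 := by
      intro h
      simp only [mem_union]; left; left; right
      refine mem_filter.2 ⟨he, a, ha, b, hb, c, hc, d, hd, heq, ?_⟩
      rcases h with h | ⟨h1, h2⟩
      · exact Or.inr (Or.inl h)
      · exact Or.inr (Or.inr ⟨haX, h1, h2, heE⟩)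
    have toM3 : (c ∈ Δ3 ∨ (c ∈ U3 ∧ ¬ (b ∈ U2 ∧ d ∈ U4))) → e ∈ ((M0 ∪ M2) ∪ M3) ∪ M4 := by
      intro h
      simp only [mem_union]; left; right
      refine mem_filter.2 ⟨he, a, ha, c, hc, b, hb, d, hd, heq.trans (pc _ _ _ _), ?_⟩
      rcases h with h | ⟨h1, h2⟩
      · exact Or.inr (Or.inl h)
      · exact Or.inr (Or.inr ⟨haX, h1, h2, heE⟩)
    have toM4 : (d ∈ Δ4 ∨ (d ∈ U4 ∧ ¬ (b ∈ U2 ∧ c ∈ U3))) → e ∈ ((M0 ∪ M2) ∪ M3) ∪ M4 := by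
      intro h
      simp only [mem_union]; right
      refine mem_filter.2 ⟨he, a, ha, d, hd, b, hb, c, hc, heq.trans (pd _ _ _ _), ?_⟩
      rcases h with h | ⟨h1, h2⟩
      · exact Or.inr (Or.inl h)
      · exact Or.inr (Or.inr ⟨haX, h1, h2, heE⟩)
    by_cases hb' : b ∈ Δ2
    · exact toM2 (Or.inl hb')
    by_cases hc' : c ∈ Δ3
    · exact toM3 (Or.inl hc')
    by_cases hd' : d ∈ Δ4
    · exact toM4 (Or.inl hd')
    have ib : b ∈ W2 ↔ b ∉ U2 := by
      simp only [hΔ2, mem_union, mem_sdiff] at hb'; clear * - hb' hb; tauto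
    have ic : c ∈ W3 ↔ c ∉ U3 := by
      simp only [hΔ3, mem_union, mem_sdiff] at hc'; clear * - hc' hc; tauto
    have id' : d ∈ W4 ↔ d ∉ U4 := by
      simp only [hΔ4, mem_union, mem_sdiff] at hd'; clear * - hd' hd; tauto
    rw [ib, ic, id'] at hW hU
    by_cases u2 : b ∈ U2
    · exact toM2 (Or.inr ⟨u2, by clear * - hW u2; tauto⟩)
    by_cases u3 : c ∈ U3
    · exact toM3 (Or.inr ⟨u3, by clear * - u2; tauto⟩)
    · exact toM4 (Or.inr ⟨by clear * - hU u2 u3; tauto, by clear * - u2; tauto⟩)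
  have hM0 : (M0.card : ℝ) ≤ τ * n^4 := by
    have : M0.card ≤ (V1 \ X).card * (n * (n * n)) := by
      refine card_image_le.trans ?_
      rw [card_product, card_product, card_product, c2, c3, c4]
    calc (M0.card : ℝ) ≤ (V1 \ X).card * (n * (n * n)) := by exact_mod_cast this
      _ ≤ (τ * n) * (n * (n * n)) := by gcongr
      _ = _ := by ring
  have hM2 := classCount n δ τ hτ hτ1 hδ c1 c2 c3 c4 hE Bad
    (fun x hx => by
      obtain ⟨B, hB, hB2⟩ := hbad x hx
      exact ⟨B, hB, fun y hy => hB2 y (by simp [hy])⟩)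
    (fun x hx y hy => hdeg x hx y (by simp [hy])) X Δ2 U2 U3 U4 hX hU2 hU3 hU4 D2 l3 l4 hno M2
    (fun e he => (mem_filter.1 he).2)
  have hM3 := classCount n δ τ hτ hτ1 hδ c1 c3 c2 c4 hE.perm3 Bad
    (fun x hx => by
      obtain ⟨B, hB, hB2⟩ := hbad x hx
      exact ⟨B, hB, fun y hy => hB2 y (by simp [hy])⟩)
    (fun x hx y hy => hdeg x hx y (by simp [hy])) X Δ3 U3 U2 U4 hX hU3 hU2 hU4 D3 l2 l4
    (fun x hx y hy c hc d hd => by rw [pc]; exact hno x hx c hc y hy d hd) M3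
    (fun e he => (mem_filter.1 he).2)
  have hM4 := classCount n δ τ hτ hτ1 hδ c1 c4 c2 c3 hE.perm4 Bad
    (fun x hx => by
      obtain ⟨B, hB, hB2⟩ := hbad x hx
      exact ⟨B, hB, fun y hy => hB2 y (by simp [hy])⟩)
    (fun x hx y hy => hdeg x hx y (by simp [hy])) X Δ4 U4 U2 U3 hX hU4 hU2 hU3 D4 l2 l3
    (fun x hx y hy c hc d hd => by rw [← pd]; exact hno x hx c hc d hd y hy) M4
    (fun e he => (mem_filter.1 he).2)
  have hcard : M.card ≤ M0.card + M2.card + M3.card + M4.card :=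
    (card_le_card hsub).trans ((card_union_le _ _).trans (Nat.add_le_add_right
      ((card_union_le _ _).trans (Nat.add_le_add_right (card_union_le _ _) _)) _))
  have hc' : (M.card : ℝ) ≤ M0.card + M2.card + M3.card + M4.card := by exact_mod_cast hcard
  have h4 : (0:ℝ) ≤ (n:ℝ)^4 := by positivity
  have hfin : (11 * τ + 6 * δ) * (n:ℝ)^4 ≤ ε * n^4 :=
    mul_le_mul_of_nonneg_right (by linarith) h4
  linarith

end close


section key
variable {α : Type} [DecidableEq α]

/-- normalized level count -/
noncomputable def lev (S : Finset α) (w : α → ℝ) (T : ℝ) (N n k : ℕ) : ℝ :=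
  ((S.filter (fun v => w v < (k:ℝ) * T / N)).card : ℝ) / n

lemma lev_mono (S : Finset α) (w : α → ℝ) (T : ℝ) (hT : 0 < T) (N n : ℕ) :
    Monotone (lev S w T N n) := by
  intro k l hkl
  unfold lev
  gcongr

lemma lev_le_one (S : Finset α) (w : α → ℝ) (T : ℝ) (N n : ℕ) (hS : S.card = n) (k : ℕ) :
    lev S w T N n k ≤ 1 := by
  unfold lev
  apply div_le_one_of_le₀ _ (Nat.cast_nonneg _)
  exact_mod_cast hS ▸ card_filter_le _ _

lemma one_sub_lev (S : Finset α) (w : α → ℝ) (T : ℝ) (N n : ℕ) (hn : 0 < n) (hS : S.card = n) (k : ℕ) :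
    1 - lev S w T N n k = ((S.filter (fun v => (k:ℝ) * T / N ≤ w v)).card : ℝ) / n := by
  unfold lev
  have h := card_filter_add_card_filter_not (s := S) (fun v => w v < (k:ℝ) * T / N)
  simp only [not_lt] at h
  rw [hS] at h
  have hn' : (0:ℝ) < n := by exact_mod_cast hn
  have h' : (_ : ℝ) = _ := congrArg (Nat.cast : ℕ → ℝ) h
  push_cast at h'
  field_simp
  linarith

lemma lev_pair {V1 Y C D : Finset α} {E : Finset (Finset α)} (n : ℕ) (hn : 0 < n) (δ T : ℝ)
    (hT : 0 < T) (N : ℕ) (hN : 0 < N)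
    (cC : C.card = n) (cD : D.card = n) (hE : IsPartite4 V1 Y C D E)
    (x y : α) (hx : x ∈ V1) (hy : y ∈ Y) (w w' : α → ℝ)
    (hw : ∀ c ∈ C, ∀ d ∈ D, ({x, y, c, d} : Finset α) ∈ E → T ≤ w c + w' d)
    (hdeg : (5/9 - δ) * n^2 ≤ (hdeg2 E x y : ℝ)) (k : ℕ) (hk : 2 * k ≤ N) :
    lev C w T N n k * lev D w' T N n (N-k) + lev C w T N n (N-k) * lev D w' T N n k
      - lev C w T N n k * lev D w' T N n k ≤ 4/9 + δ := by
  have hn' : (0:ℝ) < n := by exact_mod_cast hn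
  have hN' : (0:ℝ) < N := by exact_mod_cast hN
  have h := pairCount C D w w' n cC cD T ((k:ℝ) * T / N) (((N - k : ℕ):ℝ) * T / N)
    (by gcongr; omega)
    (by rw [← add_div, ← add_mul, ← Nat.cast_add, show k + (N - k) = N by omega]
        rw [mul_div_cancel_left₀ _ hN'.ne'])
    (hdeg2 E x y) (hdeg2_le_pred hE hx hy _ hw)
  unfold lev
  rw [div_mul_div_comm, div_mul_div_comm, div_mul_div_comm, ← add_div, ← sub_div,
    div_le_iff₀ (by positivity)]
  nlinarith

set_option maxHeartbeats 4000000 in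
lemma key_frac (ε : ℝ) (hε : 0 < ε) (hε1 : ε ≤ 1) (n : ℕ) (hn : 20 ≤ ε * n)
    {V1 V2 V3 V4 : Finset α} {E : Finset (Finset α)}
    (d12 : Disjoint V1 V2) (d13 : Disjoint V1 V3) (d14 : Disjoint V1 V4)
    (d23 : Disjoint V2 V3) (d24 : Disjoint V2 V4) (d34 : Disjoint V3 V4)
    (c1 : V1.card = n) (c2 : V2.card = n) (c3 : V3.card = n) (c4 : V4.card = n)
    (hE : IsPartite4 V1 V2 V3 V4 E) (Bad : α → α → Prop) (δ : ℝ) (hδ : δ = ε / 1000000)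
    (hbad1 : ∀ x ∈ V1, ∃ B : Finset α, (B.card : ℝ) ≤ δ * n ∧ ∀ y ∈ V2 ∪ V3 ∪ V4, Bad x y → y ∈ B)
    (hbad2 : ∀ y ∈ V2 ∪ V3 ∪ V4, ∃ B : Finset α, (B.card : ℝ) ≤ δ * n ∧ ∀ x ∈ V1, Bad x y → x ∈ B)
    (hdeg : ∀ x ∈ V1, ∀ y ∈ V2 ∪ V3 ∪ V4, ¬ Bad x y → (5/9 - δ) * n^2 ≤ (hdeg2 E x y : ℝ))
    (hclose : ¬ CloseToH13 ε n V1 V2 V3 V4 E) :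
    ∃ f, IsFracPM (V1 ∪ V2 ∪ V3 ∪ V4) E f ∧ (E.filter (fun e => 0 < f e)).card ≤ 4 * n + 1 := by
  have hn' : (0:ℝ) < n := by
    by_contra h
    push Not at h
    nlinarith
  have hn0 : 0 < n := by exact_mod_cast hn'
  have hEsub : ∀ e ∈ E, e ⊆ V1 ∪ V2 ∪ V3 ∪ V4 ∧ e.Nonempty := by
    intro e he
    refine ⟨(hE e he).1, ?_⟩
    obtain ⟨a, _, b, _, c, _, d, _, rfl⟩ := hE.exists_eq he
    exact ⟨a, by simp⟩
  rcases frac_or_dual (V1 ∪ V2 ∪ V3 ∪ V4) E n hn0 hEsub with ⟨f, hf, hfc⟩ | ⟨w, T0, hw, htot⟩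
  · refine ⟨f, hf, hfc.trans ?_⟩
    have h1 := card_union_le (V1 ∪ V2 ∪ V3) V4
    have h2 := card_union_le (V1 ∪ V2) V3
    have h3 := card_union_le V1 V2
    omega
  exfalso
  apply hclose
  obtain ⟨w1, w2, w3, w4, p1, p2, p3, p4, ⟨u1, hu1, z1⟩, ⟨u2, hu2, z2⟩, ⟨u3, hu3, z3⟩, ⟨u4, hu4, z4⟩,
    hcov, hsumlt⟩ := dual_normalize d12 d13 d14 d23 d24 d34 n hn0 c1 c2 c3 c4 w T0 hw htot
  clear hw htot w T0
  have hδ0 : 0 < δ := by rw [hδ]; positivity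
  have hδ1 : δ ≤ 1/1000000 := by rw [hδ]; linarith
  have hδn : δ * n ≤ 1/1000000 * n := mul_le_mul_of_nonneg_right hδ1 hn'.le
  have hδn0 : 0 ≤ δ * n := by positivity
  obtain ⟨B2, hB2, hB2'⟩ := hbad2 u2 (by simp [hu2])
  obtain ⟨B3, hB3, hB3'⟩ := hbad2 u3 (by simp [hu3])
  obtain ⟨B4, hB4, hB4'⟩ := hbad2 u4 (by simp [hu4])
  set S1 := ∑ v ∈ V1, w1 v with hS1
  set S2 := ∑ v ∈ V2, w2 v with hS2
  set S3 := ∑ v ∈ V3, w3 v with hS3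
  set S4 := ∑ v ∈ V4, w4 v with hS4
  have nS2 : 0 ≤ S2 := sum_nonneg p2
  have nS3 : 0 ≤ S3 := sum_nonneg p3
  have nS4 : 0 ≤ S4 := sum_nonneg p4
  set BB := B2 ∪ B3 ∪ B4 with hBB
  have hBBc : (BB.card : ℝ) ≤ 3 * δ * n := by
    have h : BB.card ≤ B2.card + B3.card + B4.card :=
      (card_union_le _ _).trans (Nat.add_le_add_right (card_union_le _ _) _)
    have h' : (BB.card : ℝ) ≤ B2.card + B3.card + B4.card := by exact_mod_cast h
    linarith
  set X' := V1 \ BB with hX'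
  have hX'c : (1 - 3 * δ) * n ≤ (X'.card : ℝ) := by
    have h := le_card_sdiff BB V1
    rw [c1, ← hX'] at h
    have h' : (n : ℝ) ≤ X'.card + BB.card := by
      have : n ≤ X'.card + BB.card := by omega
      exact_mod_cast this
    linarith
  have hX'pos : 0 < X'.card := by
    have : (0:ℝ) < X'.card := by linarith
    exact_mod_cast this
  obtain ⟨x0, hx0, hmin⟩ := exists_min_image X' w1 (card_pos.1 hX'pos)
  have hx0V : x0 ∈ V1 := (mem_sdiff.1 hx0).1
  have hx0B : x0 ∉ B2 ∧ x0 ∉ B3 ∧ x0 ∉ B4 := by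
    have := (mem_sdiff.1 hx0).2
    simp only [hBB, mem_union] at this
    tauto
  set b := w1 x0 with hb
  have hb0 : 0 ≤ b := p1 x0 hx0V
  set SX := ∑ v ∈ X', w1 v with hSX
  have hSX1 : SX ≤ S1 := sum_le_sum_of_subset_of_nonneg sdiff_subset (fun v hv _ => p1 v hv)
  have hSXb : X'.card * b ≤ SX := by
    have := card_nsmul_le_sum X' w1 b hmin
    rwa [nsmul_eq_mul] at this
  have hSXb' : (1 - 3 * δ) * n * b ≤ SX := (mul_le_mul_of_nonneg_right hX'c hb0).trans hSXb
  have hb12 : b ≤ 1/2 := by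
    by_contra hbc
    push Not at hbc
    obtain ⟨B1, hB1, hB1'⟩ := hbad1 u1 hu1
    set Y' := V2 \ B1 with hY'
    have hY'c : (1 - δ) * n ≤ (Y'.card : ℝ) := by
      have h := le_card_sdiff B1 V2
      rw [c2, ← hY'] at h
      have h' : (n : ℝ) ≤ Y'.card + B1.card := by
        have : n ≤ Y'.card + B1.card := by omega
        exact_mod_cast this
      linarith
    have hY'pos : 0 < Y'.card := by
      have : (0:ℝ) < Y'.card := by linarith
      exact_mod_cast this
    obtain ⟨y0, hy0, hymin⟩ := exists_min_image Y' w2 (card_pos.1 hY'pos)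
    have hy0V : y0 ∈ V2 := (mem_sdiff.1 hy0).1
    set c := w2 y0 with hc
    have hc0 : 0 ≤ c := p2 y0 hy0V
    have hS2c : (1 - δ) * n * c ≤ S2 := by
      have h1 := card_nsmul_le_sum Y' w2 c hymin
      rw [nsmul_eq_mul] at h1
      have h2 : ∑ v ∈ Y', w2 v ≤ S2 := sum_le_sum_of_subset_of_nonneg sdiff_subset (fun v hv _ => p2 v hv)
      have h3 := mul_le_mul_of_nonneg_right hY'c hc0
      linarith
    have hS1b : (1 - 3 * δ) * n * (1/2) ≤ S1 := by
      refine le_trans ?_ (hSXb'.trans hSX1)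
      apply mul_le_mul_of_nonneg_left hbc.le
      linarith
    by_cases hc1 : c ≤ 1
    · have hd := hdeg u1 hu1 y0 (by simp [hy0V]) (fun h => (mem_sdiff.1 hy0).2 (hB1' y0 (by simp [hy0V]) h))
      have hle := hdeg2_le_pred hE hu1 hy0V (fun p => 1 - c ≤ w3 p.1 + w4 p.2) (fun c' hc' d' hd' he => by
        have := hcov u1 hu1 y0 hy0V c' hc' d' hd' he
        rw [z1, ← hc] at this
        show 1 - c ≤ w3 c' + w4 d'
        linarith)
      have hmark := card_nsmul_le_sum ((V3 ×ˢ V4).filter (fun p => 1 - c ≤ w3 p.1 + w4 p.2))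
        (fun p => w3 p.1 + w4 p.2) (1 - c) (fun p hp => (mem_filter.1 hp).2)
      rw [nsmul_eq_mul] at hmark
      have hall : ∑ p ∈ (V3 ×ˢ V4).filter (fun p => 1 - c ≤ w3 p.1 + w4 p.2), (w3 p.1 + w4 p.2)
          ≤ n * (S3 + S4) := by
        refine (sum_le_sum_of_subset_of_nonneg (filter_subset _ _) (fun p hp _ => ?_)).trans ?_
        · rw [mem_product] at hp
          exact add_nonneg (p3 _ hp.1) (p4 _ hp.2)
        · rw [sum_product]
          simp only [sum_add_distrib, sum_const, c3, c4, nsmul_eq_mul, ← mul_sum]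
          rw [← hS3, ← hS4]
          linarith
      have hle' : (hdeg2 E u1 y0 : ℝ) ≤ ((V3 ×ˢ V4).filter (fun p => 1 - c ≤ w3 p.1 + w4 p.2)).card := by
        exact_mod_cast hle
      have h5 : (5/9 - δ) * n^2 * (1 - c) ≤ n * (S3 + S4) :=
        (mul_le_mul_of_nonneg_right (hd.trans hle') (by linarith)).trans (hmark.trans hall)
      have h6 : (5/9 - δ) * n * (1 - c) ≤ S3 + S4 := by
        apply le_of_mul_le_mul_left _ hn'
        linarith
      have h7 : (5/9 - δ) * n * 1 ≤ (5/9 - δ) * n * (1 - c) + (1 - δ) * n * c := by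
        linarith [mul_nonneg hn'.le hc0]
      linarith
    · push Not at hc1
      have : (1 - δ) * n * 1 ≤ (1 - δ) * n * c := by
        apply mul_le_mul_of_nonneg_left hc1.le
        linarith
      linarith
  -- main case
  set T := 1 - b with hT
  have hT12 : 1/2 ≤ T := by linarith
  have hT0 : 0 < T := by linarith
  obtain ⟨κ, hκ⟩ : ∃ κ, κ = ε / 1000 := ⟨_, rfl⟩
  have hκ0 : 0 < κ := by rw [hκ]; positivity
  have hκδ : κ = 1000 * δ := by rw [hκ, hδ]; ring
  obtain ⟨M, hM⟩ : ∃ M : ℕ, M = ⌈2 / κ⌉₊ := ⟨_, rfl⟩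
  have hMκ : 2 ≤ M * κ := by
    have := Nat.le_ceil (2 / κ)
    rw [← hM, div_le_iff₀ hκ0] at this
    exact this
  have hM1 : 1 ≤ M := by
    rcases Nat.eq_zero_or_pos M with h | h
    · rw [h] at hMκ; norm_num at hMκ
    · exact h
  obtain ⟨N, hN⟩ : ∃ N : ℕ, N = 4 * M := ⟨_, rfl⟩
  have hNM : (N:ℝ) = 4 * M := by rw [hN]; push_cast; ring
  have hN0 : 0 < N := by omega
  have hN' : (0:ℝ) < N := by exact_mod_cast hN0
  have hNκ : 8 ≤ N * κ := by rw [hNM]; linarith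
  have hS234 : S2 + S3 + S4 ≤ n * T * (1 + 6 * δ) := by
    have : n * (1 - (1 - 3 * δ) * b) ≤ n * (T * (1 + 6 * δ)) := by
      apply mul_le_mul_of_nonneg_left _ hn'.le
      rw [hT]; nlinarith
    nlinarith
  have pc : ∀ a b c d : α, ({a, b, c, d} : Finset α) = {a, c, b, d} := by
    intro a b c d; ext v; simp only [mem_insert, mem_singleton]; tauto
  have pd : ∀ a b c d : α, ({a, b, c, d} : Finset α) = {a, d, b, c} := by
    intro a b c d; ext v; simp only [mem_insert, mem_singleton]; tauto
  have F34 := lev_pair n hn0 δ T hT0 N hN0 c3 c4 hE x0 u2 hx0V hu2 w3 w4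
    (fun c hc d hd he => by
      have := hcov x0 hx0V u2 hu2 c hc d hd he
      linarith)
    (hdeg x0 hx0V u2 (by simp [hu2]) (fun h => hx0B.1 (hB2' x0 hx0V h)))
  have F24 := lev_pair n hn0 δ T hT0 N hN0 c2 c4 hE.perm3 x0 u3 hx0V hu3 w2 w4
    (fun c hc d hd he => by
      rw [pc] at he
      have := hcov x0 hx0V c hc u3 hu3 d hd he
      linarith)
    (hdeg x0 hx0V u3 (by simp [hu3]) (fun h => hx0B.2.1 (hB3' x0 hx0V h)))
  have F23 := lev_pair n hn0 δ T hT0 N hN0 c2 c3 hE.perm4 x0 u4 hx0V hu4 w2 w3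
    (fun c hc d hd he => by
      rw [← pd] at he
      have := hcov x0 hx0V c hc d hd u4 hu4 he
      linarith)
    (hdeg x0 hx0V u4 (by simp [hu4]) (fun h => hx0B.2.2 (hB4' x0 hx0V h)))
  have hsumle : ∑ k ∈ Icc 1 (N-1), ((1 - lev V2 w2 T N n k) + (1 - lev V3 w3 T N n k)
      + (1 - lev V4 w4 T N n k)) ≤ N / T * (S2 + S3 + S4) / n := by
    simp only [one_sub_lev V2 w2 T N n hn0 c2, one_sub_lev V3 w3 T N n hn0 c3,
      one_sub_lev V4 w4 T N n hn0 c4]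
    rw [sum_add_distrib, sum_add_distrib, ← sum_div, ← sum_div, ← sum_div, ← add_div, ← add_div]
    have a2 := levelSum V2 w2 N hN0 T hT0 p2
    have a3 := levelSum V3 w3 N hN0 T hT0 p3
    have a4 := levelSum V4 w4 N hN0 T hT0 p4
    gcongr
    rw [mul_add, mul_add]
    linarith
  have hsumle2 : N / T * (S2 + S3 + S4) / n ≤ N * (1 + 6 * δ) := by
    rw [div_le_iff₀ hn', div_mul_eq_mul_div, div_le_iff₀ hT0]
    have := mul_le_mul_of_nonneg_left hS234 hN'.le
    linarith
  obtain ⟨⟨k, hk1, hkM, ⟨l2, r2⟩, ⟨l3, r3⟩, ⟨l4, r4⟩⟩, hlow⟩ := avgLemma _ _ _ δ κ M N hN hM1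
    (lev_mono V2 w2 T hT0 N n) (lev_mono V3 w3 T hT0 N n) (lev_mono V4 w4 T hT0 N n)
    (lev_le_one V2 w2 T N n c2) (lev_le_one V3 w3 T N n c3) (lev_le_one V4 w4 T N n c4)
    hδ0 (by linarith) (by linarith) hNκ F23 F24 F34 (hsumle.trans hsumle2)
  have hlow2 : n * T * (1 - κ/8 - 18 * δ) ≤ S2 + S3 + S4 := by
    have h1 := hlow.trans hsumle
    rw [le_div_iff₀ hn', div_mul_eq_mul_div, le_div_iff₀ hT0] at h1
    have h2 : N * (1 - κ/8 - 18 * δ) ≤ (N - 1) * (1 - 18 * δ) := by nlinarith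
    have h3 : N * (1 - κ/8 - 18 * δ) * (n * T) ≤ (N - 1) * (1 - 18 * δ) * (n * T) :=
      mul_le_mul_of_nonneg_right h2 (by positivity)
    apply le_of_mul_le_mul_left _ hN'
    linarith
  obtain ⟨τ, hτ⟩ : ∃ τ, τ = 70 * (δ + κ) := ⟨_, rfl⟩
  set X := V1.filter (fun x => w1 x < b + 1/8) with hX
  have hXc : ((V1 \ X).card : ℝ) ≤ τ * n := by
    have hsub : V1 \ X ⊆ BB ∪ X'.filter (fun x => 1/8 ≤ w1 x - b) := by
      intro x hx
      rw [mem_sdiff, hX, mem_filter] at hx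
      rw [mem_union, mem_filter, hX', mem_sdiff]
      by_cases hxB : x ∈ BB
      · exact Or.inl hxB
      · right
        refine ⟨⟨hx.1, hxB⟩, ?_⟩
        have : ¬ (w1 x < b + 1/8) := fun h => hx.2 ⟨hx.1, h⟩
        linarith
    have hc1 : (V1 \ X).card ≤ BB.card + (X'.filter (fun x => 1/8 ≤ w1 x - b)).card :=
      (card_le_card hsub).trans (card_union_le _ _)
    have hc2 : ((V1 \ X).card : ℝ) ≤ BB.card + (X'.filter (fun x => 1/8 ≤ w1 x - b)).card := by
      exact_mod_cast hc1
    have hmk := card_nsmul_le_sum (X'.filter (fun x => 1/8 ≤ w1 x - b)) (fun x => w1 x - b) (1/8)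
      (fun x hx => (mem_filter.1 hx).2)
    rw [nsmul_eq_mul] at hmk
    have hle : ∑ x ∈ X'.filter (fun x => 1/8 ≤ w1 x - b), (w1 x - b) ≤ ∑ x ∈ X', (w1 x - b) :=
      sum_le_sum_of_subset_of_nonneg (filter_subset _ _) (fun x hx _ => sub_nonneg.2 (hmin x hx))
    have hre : ∑ x ∈ X', (w1 x - b) = SX - X'.card * b := by
      rw [sum_sub_distrib, sum_const, nsmul_eq_mul]
    rw [hre] at hle
    have hXb : (1 - 3 * δ) * n * b ≤ X'.card * b := mul_le_mul_of_nonneg_right hX'c hb0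
    have hnT : n * T * (κ/8 + 18 * δ) ≤ n * (κ/8 + 18 * δ) := by
      have h1 : n * T ≤ n * 1 := mul_le_mul_of_nonneg_left (by linarith) hn'.le
      have := mul_le_mul_of_nonneg_right h1 (by positivity : 0 ≤ κ/8 + 18 * δ)
      linarith
    have hnb : δ * n * b ≤ δ * n * (1/2) := mul_le_mul_of_nonneg_left hb12 (by positivity)
    have hTb : n * T = n - n * b := by rw [hT]; ring
    have hSS : SX - X'.card * b ≤ n * (κ/8 + 18 * δ) + 3/2 * (δ * n) := by
      nlinarith
    have hfin : 8 * (n * (κ/8 + 18 * δ) + 3/2 * (δ * n)) + 3 * δ * n ≤ τ * n := by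
      rw [hτ, hκδ]; nlinarith [mul_pos hδ0 hn']
    linarith
  have conv : ∀ (S : Finset α) (w : α → ℝ) (x : ℝ), lev S w T N n k * n = x →
      ((S.filter (fun v => w v < (k:ℝ) * T / N)).card : ℝ) = x := by
    intro S w x h
    rw [← h, lev, div_mul_cancel₀ _ hn'.ne']
  have cv2 := conv V2 w2 _ rfl
  have cv3 := conv V3 w3 _ rfl
  have cv4 := conv V4 w4 _ rfl
  have hτ6 : 6 * (δ + κ) ≤ τ := by rw [hτ]; linarith
  refine close_of_cover n δ τ ε (by linarith) (by linarith) hδ0.le (by linarith)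
    (by rw [hτ, hκ, hδ]; linarith) (by rw [hτ, hκ, hδ]; nlinarith) c1 c2 c3 c4 hE Bad hbad1 hdeg X
    (V2.filter (fun v => w2 v < (k:ℝ) * T / N)) (V3.filter (fun v => w3 v < (k:ℝ) * T / N))
    (V4.filter (fun v => w4 v < (k:ℝ) * T / N)) (filter_subset _ _) (filter_subset _ _)
    (filter_subset _ _) (filter_subset _ _) hXc ?_ ?_ ?_ ?_ ?_ ?_ ?_
  · rw [cv2]; gcongr; linarith
  · rw [cv3]; gcongr; linarith
  · rw [cv4]; gcongr; linarith
  · rw [cv2]; gcongr; linarith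
  · rw [cv3]; gcongr; linarith
  · rw [cv4]; gcongr; linarith
  · intro x hx y hy c hc d hd he
    rw [mem_filter] at hy hc hd
    rw [hX, mem_filter] at hx
    have h1 := hcov x hx.1 y hy.1 c hc.1 d hd.1 he
    have h2 : (k:ℝ) * T / N ≤ T / 4 := by
      rw [div_le_iff₀ hN', hNM]
      have : (k:ℝ) ≤ M := by exact_mod_cast hkM
      nlinarith
    linarith [hx.2, hy.2, hc.2, hd.2]

end key


section greedy
variable {α : Type} [DecidableEq α] {V1 V2 V3 V4 : Finset α} {E : Finset (Finset α)}

lemma IsPartite4.card_eq (d12 : Disjoint V1 V2) (d13 : Disjoint V1 V3) (d14 : Disjoint V1 V4)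
    (d23 : Disjoint V2 V3) (d24 : Disjoint V2 V4) (d34 : Disjoint V3 V4)
    (h : IsPartite4 V1 V2 V3 V4 E) {e : Finset α} (he : e ∈ E) : e.card = 4 := by
  obtain ⟨a, ha, b, hb, c, hc, d, hd, rfl⟩ := h.exists_eq he
  have n1 := disjoint_left.1 d12 ha
  have n2 := disjoint_left.1 d13 ha
  have n3 := disjoint_left.1 d14 ha
  have n4 := disjoint_left.1 d23 hb
  have n5 := disjoint_left.1 d24 hb
  have n6 := disjoint_left.1 d34 hc
  have e1 : a ≠ b := fun h => n1 (h ▸ hb)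
  have e2 : a ≠ c := fun h => n2 (h ▸ hc)
  have e3 : a ≠ d := fun h => n3 (h ▸ hd)
  have e4 : b ≠ c := fun h => n4 (h ▸ hc)
  have e5 : b ≠ d := fun h => n5 (h ▸ hd)
  have e6 : c ≠ d := fun h => n6 (h ▸ hd)
  rw [card_insert_of_notMem (by simp [e1, e2, e3]), card_insert_of_notMem (by simp [e4, e5]),
    card_insert_of_notMem (by simp [e6]), card_singleton]

lemma four_third {e : Finset α} (he : e.card = 4) {a b c : α} (ha : a ∈ e) (hb : b ∈ e)
    (hc : c ∈ e) (hab : a ≠ b) (hac : a ≠ c) (hbc : b ≠ c) : ∃ z ∈ e, e = {a, b, c, z} := by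
  have h3 : ({a, b, c} : Finset α).card = 3 := by
    rw [card_insert_of_notMem (by simp [hab, hac]), card_insert_of_notMem (by simp [hbc]),
      card_singleton]
  have hsub : ({a, b, c} : Finset α) ⊆ e := by
    intro v hv
    simp only [mem_insert, mem_singleton] at hv
    rcases hv with rfl | rfl | rfl <;> assumption
  have h1 : (e \ {a, b, c}).card = 1 := by
    rw [card_sdiff_of_subset hsub]; omega
  obtain ⟨z, hz⟩ := card_eq_one.1 h1
  have hz' : z ∈ e \ {a, b, c} := by rw [hz]; simp
  refine ⟨z, (mem_sdiff.1 hz').1, ?_⟩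
  rw [← sdiff_union_of_subset hsub, hz]
  ext v
  simp only [mem_union, mem_insert, mem_singleton]
  tauto

lemma four_eq {e : Finset α} (he : e.card = 4) {a b c d : α} (ha : a ∈ e) (hb : b ∈ e)
    (hc : c ∈ e) (hd : d ∈ e) (hab : a ≠ b) (hac : a ≠ c) (hbc : b ≠ c) (had : a ≠ d)
    (hbd : b ≠ d) (hcd : c ≠ d) : e = {a, b, c, d} := by
  symm
  apply eq_of_subset_of_card_le
  · intro v hv
    simp only [mem_insert, mem_singleton] at hv
    rcases hv with rfl | rfl | rfl | rfl <;> assumption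
  · rw [card_insert_of_notMem (by simp [hab, hac, had]), card_insert_of_notMem (by simp [hbc, hbd]),
      card_insert_of_notMem (by simp [hcd]), card_singleton, he]

lemma lost_edges (V : Finset α) (h4 : ∀ e ∈ E, e.card = 4) (hV : ∀ e ∈ E, e ⊆ V)
    (E' F : Finset (Finset α)) (S : α → Finset α) (s : ℕ)
    (hS : ∀ p q, q ∈ S p → p ≠ q) (hsym : ∀ p ∈ V, ∀ q ∈ V, q ∈ S p → p ∈ S q)
    (hs : ∀ p ∈ V, (S p).card ≤ s)
    (hE' : ∀ e ∈ E, e ∉ E' → e ∈ F ∨ ∃ p ∈ e, ∃ q ∈ e, q ∈ S p)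
    (x y : α) (hx : x ∈ V) (hy : y ∈ V) (hxy : x ≠ y) (hns : y ∉ S x) :
    hdeg2 E x y ≤ hdeg2 E' x y + F.card + 3 * (V.card * s) := by
  set I1 := (V ×ˢ S x).image (fun p => ({x, y, p.2, p.1} : Finset α)) with hI1
  set I2 := (V ×ˢ S y).image (fun p => ({x, y, p.2, p.1} : Finset α)) with hI2
  set I3 := (V.sigma S).image (fun p => ({x, y, p.1, p.2} : Finset α)) with hI3
  have c1 : I1.card ≤ V.card * s := by
    refine card_image_le.trans ?_
    rw [card_product]
    exact Nat.mul_le_mul_left _ (hs x hx)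
  have c2 : I2.card ≤ V.card * s := by
    refine card_image_le.trans ?_
    rw [card_product]
    exact Nat.mul_le_mul_left _ (hs y hy)
  have c3 : I3.card ≤ V.card * s := by
    refine card_image_le.trans ?_
    rw [card_sigma]
    exact sum_le_card_nsmul _ _ _ hs
  have hns' : x ∉ S y := fun h => hns (hsym y hy x hx h)
  have hcover : E.filter (fun e => x ∈ e ∧ y ∈ e) ⊆
      E'.filter (fun e => x ∈ e ∧ y ∈ e) ∪ F ∪ (I1 ∪ I2 ∪ I3) := by
    intro e he
    obtain ⟨heE, hxe, hye⟩ := mem_filter.1 he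
    by_cases hE1 : e ∈ E'
    · exact mem_union_left _ (mem_union_left _ (mem_filter.2 ⟨hE1, hxe, hye⟩))
    rcases hE' e heE hE1 with hF | ⟨p, hp, q, hq, hpq⟩
    · exact mem_union_left _ (mem_union_right _ hF)
    apply mem_union_right
    have hc := h4 e heE
    have hsubV := hV e heE
    have k1 : ∀ r ∈ e, r ∈ S x → e ∈ I1 := by
      intro r hr hrS
      obtain ⟨z, hz, hez⟩ := four_third hc hxe hye hr hxy (hS x r hrS)
        (fun h => hns (h ▸ hrS))
      exact mem_image.2 ⟨(z, r), mem_product.2 ⟨hsubV hz, hrS⟩, hez.symm⟩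
    have k2 : ∀ r ∈ e, r ∈ S y → e ∈ I2 := by
      intro r hr hrS
      obtain ⟨z, hz, hez⟩ := four_third hc hxe hye hr hxy (fun h => hns' (h ▸ hrS))
        (hS y r hrS)
      exact mem_image.2 ⟨(z, r), mem_product.2 ⟨hsubV hz, hrS⟩, hez.symm⟩
    have hqp := hsym p (hsubV hp) q (hsubV hq) hpq
    rw [mem_union, mem_union]
    by_cases e1 : x = p
    · exact Or.inl (Or.inl (k1 q hq (e1 ▸ hpq)))
    by_cases e2 : x = q
    · exact Or.inl (Or.inl (k1 p hp (e2 ▸ hqp)))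
    by_cases e3 : y = p
    · exact Or.inl (Or.inr (k2 q hq (e3 ▸ hpq)))
    by_cases e4 : y = q
    · exact Or.inl (Or.inr (k2 p hp (e4 ▸ hqp)))
    · right
      exact mem_image.2 ⟨⟨p, q⟩, mem_sigma.2 ⟨hsubV hp, hpq⟩,
        (four_eq hc hxe hye hp hq hxy e1 e3 e2 e4 (hS p q hpq)).symm⟩
  have t1 := card_le_card hcover
  have t2 := card_union_le (E'.filter (fun e => x ∈ e ∧ y ∈ e) ∪ F) (I1 ∪ I2 ∪ I3)
  have t3 := card_union_le (E'.filter (fun e => x ∈ e ∧ y ∈ e)) F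
  have t4 := card_union_le (I1 ∪ I2) I3
  have t5 := card_union_le I1 I2
  unfold hdeg2
  omega

lemma row_sum (V : Finset α) (h4 : ∀ e ∈ E, e.card = 4) (f : Finset α → ℝ) (hf : IsFracPM V E f)
    (x : α) (hx : x ∈ V) :
    ∑ y ∈ V.erase x, ∑ e ∈ E.filter (fun e => x ∈ e ∧ y ∈ e), f e ≤ 3 := by
  have h1 : ∀ y, ∑ e ∈ E.filter (fun e => x ∈ e ∧ y ∈ e), f e =
      ∑ e ∈ E.filter (fun e => x ∈ e), if y ∈ e then f e else 0 := by
    intro y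
    rw [← sum_filter, filter_filter]
  simp only [h1]
  rw [sum_comm]
  have h2 : ∀ e ∈ E.filter (fun e => x ∈ e),
      (∑ y ∈ V.erase x, if y ∈ e then f e else 0) ≤ 3 * f e := by
    intro e he
    obtain ⟨heE, hxe⟩ := mem_filter.1 he
    rw [← sum_filter, sum_const, nsmul_eq_mul]
    apply mul_le_mul_of_nonneg_right _ (hf.2.1 e heE).1
    have hsub : (V.erase x).filter (fun y => y ∈ e) ⊆ e.erase x := by
      intro v hv
      rw [mem_filter, mem_erase] at hv
      exact mem_erase.2 ⟨hv.1.1, hv.2⟩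
    have := card_le_card hsub
    rw [card_erase_of_mem hxe, h4 e heE] at this
    exact_mod_cast this
  refine (sum_le_sum h2).trans ?_
  rw [← mul_sum, hf.2.2 x hx]
  norm_num

lemma IsFracPM.pair_le_one {V : Finset α} {f : Finset α → ℝ} (hf : IsFracPM V E f)
    {x : α} (hx : x ∈ V) (y : α) :
    ∑ e ∈ E.filter (fun e => x ∈ e ∧ y ∈ e), f e ≤ 1 := by
  rw [← hf.2.2 x hx]
  apply sum_le_sum_of_subset_of_nonneg
  · intro e he
    rw [mem_filter] at he ⊢
    exact ⟨he.1, he.2.1⟩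
  · intro e he _
    exact (hf.2.1 e (mem_filter.1 he).1).1

lemma IsFracPM.extend {V : Finset α} {E' : Finset (Finset α)} {f : Finset α → ℝ}
    (hf : IsFracPM V E' f) (hE : E' ⊆ E) : IsFracPM V E f := by
  refine ⟨fun e he => hf.1 e (fun h => he (hE h)), fun e _ => ?_, fun v hv => ?_⟩
  · by_cases h : e ∈ E'
    · exact hf.2.1 e h
    · rw [hf.1 e h]; norm_num
  · rw [← hf.2.2 v hv]
    symm
    apply sum_subset
    · exact filter_subset_filter _ hE
    · intro e he hne
      apply hf.1
      intro h
      exact hne (mem_filter.2 ⟨h, (mem_filter.1 he).2⟩)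

lemma greedy (ε : ℝ) (hε : 0 < ε) (hε1 : ε ≤ 1) (n : ℕ) (hn : 20 ≤ ε * n)
    (d12 : Disjoint V1 V2) (d13 : Disjoint V1 V3) (d14 : Disjoint V1 V4)
    (d23 : Disjoint V2 V3) (d24 : Disjoint V2 V4) (d34 : Disjoint V3 V4)
    (c1 : V1.card = n) (c2 : V2.card = n) (c3 : V3.card = n) (c4 : V4.card = n)
    (hE : IsPartite4 V1 V2 V3 V4 E) (δ : ℝ) (hδ : δ = ε / 1000000)
    (hdeg : ∀ x ∈ V1, ∀ y ∈ V2 ∪ V3 ∪ V4, (5/9 - δ/2) * n^2 ≤ (hdeg2 E x y : ℝ))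
    (hclose : ¬ CloseToH13 ε n V1 V2 V3 V4 E) (t : ℕ) (ht : (t:ℝ) ≤ δ / 100 * n) :
    ∃ f : ℕ → Finset α → ℝ, (∀ i < t, IsFracPM (V1 ∪ V2 ∪ V3 ∪ V4) E (f i) ∧
        (E.filter (fun e => 0 < f i e)).card ≤ 4 * n + 1) ∧
      (∀ i < t, ∀ j < t, i ≠ j → ∀ e : Finset α, ¬ (0 < f i e ∧ 0 < f j e)) ∧
      (∀ x ∈ V1 ∪ V2 ∪ V3 ∪ V4, ∀ y ∈ V1 ∪ V2 ∪ V3 ∪ V4, x ≠ y →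
            ∑ i ∈ range t, ∑ e ∈ E.filter (fun e => x ∈ e ∧ y ∈ e), f i e ≤ 3) := by
  classical
  have h4 : ∀ e ∈ E, e.card = 4 := fun e he => hE.card_eq d12 d13 d14 d23 d24 d34 he
  have hsubV : ∀ e ∈ E, e ⊆ V1 ∪ V2 ∪ V3 ∪ V4 := fun e he => (hE e he).1
  have hVc : (V1 ∪ V2 ∪ V3 ∪ V4).card ≤ 4 * n := by
    have h1 := card_union_le (V1 ∪ V2 ∪ V3) V4
    have h2 := card_union_le (V1 ∪ V2) V3
    have h3 := card_union_le V1 V2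
    omega
  have hV1 : ∀ x ∈ V1, x ∈ V1 ∪ V2 ∪ V3 ∪ V4 := by
    intro x hx; simp [hx]
  have hV234 : ∀ x ∈ V2 ∪ V3 ∪ V4, x ∈ V1 ∪ V2 ∪ V3 ∪ V4 := by
    intro x hx
    simp only [mem_union] at hx ⊢
    tauto
  have hne : ∀ x ∈ V1, ∀ y ∈ V2 ∪ V3 ∪ V4, x ≠ y := by
    rintro x hx y hy rfl
    simp only [mem_union] at hy
    rcases hy with (hy | hy) | hy
    · exact disjoint_left.1 d12 hx hy
    · exact disjoint_left.1 d13 hx hy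
    · exact disjoint_left.1 d14 hx hy
  have hδ0 : 0 < δ := by rw [hδ]; positivity
  have hn' : (0:ℝ) < n := by
    by_contra h
    push Not at h
    nlinarith
  have hn1 : (1:ℝ) ≤ n := by
    have : 0 < n := by exact_mod_cast hn'
    exact_mod_cast this
  generalize hVdef : V1 ∪ V2 ∪ V3 ∪ V4 = V at *
  induction t with
  | zero => exact ⟨fun _ _ => 0, by simp, by simp, by simp⟩
  | succ t ih =>
    push_cast at ht
    have ht' : (t:ℝ) ≤ δ / 100 * n := by linarith
    obtain ⟨f, hf1, hf2, hf3⟩ := ih ht'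
    set W : α → α → ℝ := fun x y =>
      ∑ i ∈ range t, ∑ e ∈ E.filter (fun e => x ∈ e ∧ y ∈ e), f i e with hW
    have hWsym : ∀ x y, W x y = W y x := by
      intro x y
      simp only [hW, and_comm]
    have hWnn : ∀ x y, 0 ≤ W x y := by
      intro x y
      apply sum_nonneg
      intro i hi
      apply sum_nonneg
      intro e he
      exact ((hf1 i (mem_range.1 hi)).1.2.1 e (mem_filter.1 he).1).1
    set S : α → Finset α := fun x => (V.erase x).filter (fun y => 2 < W x y) with hS
    have hSmem : ∀ x y, y ∈ S x ↔ (y ≠ x ∧ y ∈ V) ∧ 2 < W x y := by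
      intro x y
      rw [hS, mem_filter, mem_erase]
    have hScard : ∀ x ∈ V, (S x).card ≤ 2 * t := by
      intro x hx
      have h1 : ∑ y ∈ V.erase x, W x y ≤ 3 * t := by
        simp only [hW]
        rw [sum_comm]
        have := sum_le_card_nsmul (range t) (fun i => ∑ y ∈ V.erase x,
          ∑ e ∈ E.filter (fun e => x ∈ e ∧ y ∈ e), f i e) 3
          (fun i hi => row_sum V h4 (f i) (hf1 i (mem_range.1 hi)).1 x hx)
        rw [card_range, nsmul_eq_mul] at this
        linarith
      have h2 := card_nsmul_le_sum (S x) (fun y => W x y) 2 (fun y hy => ((hSmem x y).1 hy).2.le)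
      have h3 : ∑ y ∈ S x, W x y ≤ ∑ y ∈ V.erase x, W x y :=
        sum_le_sum_of_subset_of_nonneg (filter_subset _ _) (fun y _ _ => hWnn x y)
      rw [nsmul_eq_mul] at h2
      have h5 : ((S x).card : ℝ) ≤ 2 * t := by
        have : (0:ℝ) ≤ t := Nat.cast_nonneg _
        linarith
      exact_mod_cast h5
    have hScardR : ∀ x ∈ V, ((S x).card : ℝ) ≤ δ * n := by
      intro x hx
      have h1 : ((S x).card : ℝ) ≤ 2 * t := by exact_mod_cast hScard x hx
      have : 0 ≤ δ * n := by positivity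
      linarith
    have hSsym : ∀ p ∈ V, ∀ q ∈ V, q ∈ S p → p ∈ S q := by
      intro p hp q hq h
      rw [hSmem] at h ⊢
      exact ⟨⟨h.1.1.symm, hp⟩, hWsym p q ▸ h.2⟩
    have hSne : ∀ p q, q ∈ S p → p ≠ q := fun p q h => ((hSmem p q).1 h).1.1.symm
    set F := (range t).biUnion (fun i => E.filter (fun e => 0 < f i e)) with hF
    have hFc : F.card ≤ t * (4 * n + 1) := by
      have := card_biUnion_le_card_mul (range t) (fun i => E.filter (fun e => 0 < f i e)) (4 * n + 1)
        (fun i hi => (hf1 i (mem_range.1 hi)).2)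
      rwa [card_range] at this
    set E' := E.filter (fun e => e ∉ F ∧ ∀ p ∈ e, ∀ q ∈ e, q ∉ S p) with hE'
    have hE'E : E' ⊆ E := filter_subset _ _
    have hlost := lost_edges (E := E) V h4 hsubV E' F S (2 * t) hSne hSsym hScard (by
      intro e he hne
      by_contra hcon
      push Not at hcon
      exact hne (mem_filter.2 ⟨he, hcon⟩))
    have hclose' : ¬ CloseToH13 ε n V1 V2 V3 V4 E' := by
      rintro ⟨W2, W3, W4, hWc, hWle⟩
      refine hclose ⟨W2, W3, W4, hWc, le_trans ?_ hWle⟩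
      exact_mod_cast card_le_card (sdiff_subset_sdiff (Subset.refl _) hE'E)
    obtain ⟨g, hg, hgc⟩ := key_frac ε hε hε1 n hn d12 d13 d14 d23 d24 d34 c1 c2 c3 c4
      (hE.mono hE'E) (fun x y => y ∈ S x) δ hδ
      (fun x hx => ⟨S x, hScardR x (hV1 x hx), fun y _ h => h⟩)
      (fun y hy => ⟨S y, hScardR y (hV234 y hy), fun x hx h =>
        hSsym x (hV1 x hx) y (hV234 y hy) h⟩)
      (fun x hx y hy hns => by
        have h1 := hlost x y (hV1 x hx) (hV234 y hy) (hne x hx y hy) hns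
        have h2 : V.card * (2 * t) ≤ 4 * n * (2 * t) := Nat.mul_le_mul_right _ hVc
        have h3 : hdeg2 E x y ≤ hdeg2 E' x y + t * (4 * n + 1) + 3 * (4 * n * (2 * t)) := by omega
        have h4 : (hdeg2 E x y : ℝ) ≤ hdeg2 E' x y + t * (4 * n + 1) + 3 * (4 * n * (2 * t)) := by
          exact_mod_cast h3
        have h5 := hdeg x hx y hy
        have h6 : (t:ℝ) * n ≤ δ / 100 * n * n := mul_le_mul_of_nonneg_right ht' hn'.le
        have h7 : (t:ℝ) * 1 ≤ t * n := mul_le_mul_of_nonneg_left hn1 (Nat.cast_nonneg _)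
        have h8 : 0 ≤ δ * n * n := by positivity
        linarith)
      hclose'
    rw [hVdef] at hg
    have hgE : IsFracPM V E g := hg.extend hE'E
    have hgsupp : ∀ e, 0 < g e → e ∈ E' := by
      intro e he
      by_contra h
      rw [hg.1 e h] at he
      exact lt_irrefl _ he
    have hdisj : ∀ i < t, ∀ e, ¬ (0 < f i e ∧ 0 < g e) := by
      rintro i hi e ⟨h1, h2⟩
      have h3 := mem_filter.1 (hgsupp e h2)
      exact h3.2.1 (mem_biUnion.2 ⟨i, mem_range.2 hi, mem_filter.2 ⟨h3.1, h1⟩⟩)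
    refine ⟨fun i => if i < t then f i else g, ?_, ?_, ?_⟩
    · intro i hi
      by_cases hit : i < t
      · simp only [hit, if_true]; exact hf1 i hit
      · simp only [hit, if_false]
        refine ⟨hgE, le_trans (card_le_card ?_) hgc⟩
        intro e he
        have := (mem_filter.1 he).2
        exact mem_filter.2 ⟨hgsupp e this, this⟩
    · intro i hi j hj hij e
      by_cases hit : i < t
      · by_cases hjt : j < t
        · simp only [hit, hjt, if_true]; exact hf2 i hit j hjt hij e
        · simp only [hit, hjt, if_true, if_false]; exact hdisj i hit e
      · by_cases hjt : j < t
        · simp only [hit, hjt, if_true, if_false]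
          exact fun h => hdisj j hjt e h.symm
        · omega
    · intro x hx y hy hxy
      rw [sum_range_succ]
      have h1 : ∑ i ∈ range t, ∑ e ∈ E.filter (fun e => x ∈ e ∧ y ∈ e),
          (if i < t then f i else g) e = W x y := by
        apply sum_congr rfl
        intro i hi
        rw [if_pos (mem_range.1 hi)]
      rw [h1]
      simp only [lt_irrefl, if_false]
      by_cases hsat : y ∈ S x
      · have h2 : ∑ e ∈ E.filter (fun e => x ∈ e ∧ y ∈ e), g e = 0 := by
          apply sum_eq_zero
          intro e he
          obtain ⟨_, hxe, hye⟩ := mem_filter.1 he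
          apply hg.1
          intro h
          exact (mem_filter.1 h).2.2 x hxe y hye hsat
        rw [h2, add_zero]
        exact hf3 x hx y hy hxy
      · have h2 : W x y ≤ 2 := by
          by_contra h
          push Not at h
          exact hsat ((hSmem x y).2 ⟨⟨hxy.symm, hy⟩, h⟩)
        have h3 := hgE.pair_le_one hx y
        linarith

end greedy

theorem disjoint_fractional_perfect_matchings :
    ∃ ε0 : ℝ, 0 < ε0 ∧ ∀ ε : ℝ, 0 < ε → ε < ε0 →
    ∃ γ0 : ℝ, 0 < γ0 ∧ ∀ γ : ℝ, 0 < γ → γ < γ0 →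
    ∃ n0 : ℕ, ∀ n : ℕ, n0 ≤ n →
    ∀ (α : Type) [DecidableEq α], ∀ V1 V2 V3 V4 : Finset α,
      Disjoint V1 V2 → Disjoint V1 V3 → Disjoint V1 V4 →
      Disjoint V2 V3 → Disjoint V2 V4 → Disjoint V3 V4 →
      V1.card = n → V2.card = n → V3.card = n → V4.card = n →
      ∀ E : Finset (Finset α),
        IsPartite4 V1 V2 V3 V4 E →
        ¬ CloseToH13 ε n V1 V2 V3 V4 E →
        (∀ x ∈ V1, ∀ y ∈ V2 ∪ V3 ∪ V4,
          ((5 : ℝ) / 9 - γ) * n ^ 2 ≤ (hdeg2 E x y : ℝ)) →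
        ∃ f : Fin ⌊(n : ℝ) / Real.log n⌋₊ → Finset α → ℝ,
          (∀ i, IsFracPM (V1 ∪ V2 ∪ V3 ∪ V4) E (f i)) ∧
          (∀ i j, i ≠ j → ∀ e : Finset α, ¬ (0 < f i e ∧ 0 < f j e)) ∧
          (∀ x ∈ V1 ∪ V2 ∪ V3 ∪ V4, ∀ y ∈ V1 ∪ V2 ∪ V3 ∪ V4, x ≠ y →
            ∑ i, ∑ e ∈ E.filter (fun e => x ∈ e ∧ y ∈ e), f i e ≤ 3) := by
  refine ⟨1, one_pos, fun ε hε hε1 => ?_⟩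
  obtain ⟨δ, hδ⟩ : ∃ δ, δ = ε / 1000000 := ⟨_, rfl⟩
  have hδ0 : 0 < δ := by rw [hδ]; positivity
  refine ⟨δ / 2, by positivity, fun γ hγ hγ1 => ?_⟩
  refine ⟨max ⌈20 / ε⌉₊ ⌈Real.exp (100 / δ)⌉₊, fun n hn => ?_⟩
  intro α _ V1 V2 V3 V4 d12 d13 d14 d23 d24 d34 c1 c2 c3 c4 E hE hclose hdeg
  have hnε : 20 ≤ ε * n := by
    have h := Nat.ceil_le.1 ((le_max_left _ _).trans hn)
    rw [div_le_iff₀ hε] at h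
    linarith
  have hexp : Real.exp (100 / δ) ≤ n := Nat.ceil_le.1 ((le_max_right _ _).trans hn)
  have hlog : 100 / δ ≤ Real.log n := by
    have h := Real.log_le_log (Real.exp_pos _) hexp
    rwa [Real.log_exp] at h
  have hpos : 0 < 100 / δ := by positivity
  have ht : ((⌊(n : ℝ) / Real.log n⌋₊ : ℕ) : ℝ) ≤ δ / 100 * n := by
    have hlog0 : 0 < Real.log n := lt_of_lt_of_le hpos hlog
    refine (Nat.floor_le (by positivity)).trans ?_
    rw [div_le_iff₀ hlog0]
    have h1 : 1 ≤ δ / 100 * Real.log n := by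
      have := mul_le_mul_of_nonneg_left hlog (by positivity : 0 ≤ δ / 100)
      have h2 : δ / 100 * (100 / δ) = 1 := by field_simp
      linarith
    have h2 := mul_le_mul_of_nonneg_right h1 (Nat.cast_nonneg n : (0:ℝ) ≤ n)
    linarith
  obtain ⟨f, hf1, hf2, hf3⟩ := greedy ε hε hε1.le n hnε d12 d13 d14 d23 d24 d34 c1 c2 c3 c4 hE δ hδ
    (fun x hx y hy => le_trans (by
      apply mul_le_mul_of_nonneg_right _ (by positivity)
      linarith) (hdeg x hx y hy)) hclose _ ht
  refine ⟨fun i => f i, fun i => (hf1 i i.2).1, fun i j hij e => hf2 i i.2 j j.2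
    (fun h => hij (Fin.ext h)) e, fun x hx y hy hxy => ?_⟩
  rw [Fin.sum_univ_eq_sum_range (fun i => ∑ e ∈ E.filter (fun e => x ∈ e ∧ y ∈ e), f i e)]
  exact hf3 x hx y hy hxy
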